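/- arXiv:1510.03287 — 10 statements merged into one kernel-verified Lean document; each statement's English description precedes it below -/
import Mathlib

section
/- Let κ be a measurable cardinal, U a normal κ-complete nonprincipal ultrafilter on κ, and ℙ the Prikry forcing on κ. For every dense open subset D of ℙ and every condition p = (s, A) ∈ ℙ, there exist a set B ∈ U with B ⊆ A (so that q = (s, B) is a direct extension of p) and a natural number n such that for every n-element subset t of B, the condition (s ∪ t, B ∖ (max(t) + 1)) belongs to D. -/
/-- A condition of Prikry forcing on `κ`: a finite set `s` of ordinals together
with a set `A` of ordinals (intended to be a member of the ultrafilter `U`). -/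
structure PCond : Type 1 where
  s : Finset Ordinal.{0}
  A : Set Ordinal.{0}

/-- `U` is an ultrafilter on (the subsets of) `Set.Iio κ.ord`, i.e. on κ. -/
def IsUltrafilterOn (κ : Cardinal.{0}) (U : Set (Set Ordinal.{0})) : Prop :=
  (∀ A ∈ U, A ⊆ Set.Iio κ.ord) ∧
  Set.Iio κ.ord ∈ U ∧
  (∅ : Set Ordinal.{0}) ∉ U ∧
  (∀ A B : Set Ordinal.{0}, A ∈ U → A ⊆ B → B ⊆ Set.Iio κ.ord → B ∈ U) ∧
  (∀ A B : Set Ordinal.{0}, A ∈ U → B ∈ U → A ∩ B ∈ U) ∧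
  (∀ A : Set Ordinal.{0}, A ⊆ Set.Iio κ.ord → A ∈ U ∨ Set.Iio κ.ord \ A ∈ U)

/-- `U` is κ-complete: the intersection of fewer than κ members of `U`
(here: a family indexed by an ordinal `γ < κ`) is in `U`. -/
def IsKappaComplete (κ : Cardinal.{0}) (U : Set (Set Ordinal.{0})) : Prop :=
  ∀ γ < κ.ord, ∀ f : Ordinal.{0} → Set Ordinal.{0},
    (∀ i < γ, f i ∈ U) → (Set.Iio κ.ord ∩ ⋂ i ∈ Set.Iio γ, f i) ∈ U

/-- `U` is normal: every function `f` with `f α < α` for all `α` in some set in `U`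
is constant on a set in `U`. -/
def IsNormalOn (κ : Cardinal.{0}) (U : Set (Set Ordinal.{0})) : Prop :=
  ∀ f : Ordinal.{0} → Ordinal.{0}, (∃ A ∈ U, ∀ α ∈ A, f α < α) →
    ∃ c : Ordinal.{0}, {α : Ordinal.{0} | α < κ.ord ∧ f α = c} ∈ U

/-- `U` is nonprincipal: it contains no singleton. -/
def IsNonprincipal (U : Set (Set Ordinal.{0})) : Prop := ∀ x : Ordinal.{0}, {x} ∉ U

/-- `p` is a condition of the Prikry forcing on `κ` with ultrafilter `U`:
`p = (s, A)` with `s` a finite subset of κ, `A ∈ U`, and every element of `s`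
smaller than every element of `A`. -/
def PIsCond (κ : Cardinal.{0}) (U : Set (Set Ordinal.{0})) (p : PCond) : Prop :=
  (↑p.s : Set Ordinal.{0}) ⊆ Set.Iio κ.ord ∧ p.A ∈ U ∧
  ∀ x ∈ p.s, ∀ a ∈ p.A, x < a

/-- `q ≤ p`: `q` extends `p`. -/
def PExt (q p : PCond) : Prop :=
  p.s ⊆ q.s ∧ q.A ⊆ p.A ∧ ∀ x ∈ q.s, x ∉ p.s → x ∈ p.A

/-- `q ≤* p`: `q` is a direct extension of `p`. -/
def PDirExt (q p : PCond) : Prop := PExt q p ∧ q.s = p.s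

/-- `D` is a dense open subset of the Prikry forcing. -/
def PDenseOpen (κ : Cardinal.{0}) (U : Set (Set Ordinal.{0})) (D : Set PCond) : Prop :=
  (∀ p ∈ D, PIsCond κ U p) ∧
  (∀ p, PIsCond κ U p → ∃ q ∈ D, PExt q p) ∧
  (∀ p ∈ D, ∀ q, PIsCond κ U q → PExt q p → q ∈ D)


section PrikryHelpers

variable {κ : Cardinal.{0}} {U : Set (Set Ordinal.{0})}

lemma pk_diag (hU : IsUltrafilterOn κ U) (hnorm : IsNormalOn κ U)
    (F : Ordinal.{0} → Set Ordinal.{0}) (hF : ∀ a, F a ∈ U) :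
    {b | b < κ.ord ∧ ∀ a < b, b ∈ F a} ∈ U := by
  obtain ⟨h1, h2, h3, h4, h5, h6⟩ := hU
  rcases h6 {b | b < κ.ord ∧ ∀ a < b, b ∈ F a} (fun b hb => hb.1) with h | h
  · exact h
  · exfalso
    have key : ∀ b, ∃ a, b ∈ Set.Iio κ.ord \ {b | b < κ.ord ∧ ∀ a < b, b ∈ F a} →
        a < b ∧ b ∉ F a := by
      intro b
      by_cases hb : b ∈ Set.Iio κ.ord \ {b | b < κ.ord ∧ ∀ a < b, b ∈ F a}
      · have hb2 := hb.2
        simp only [Set.mem_setOf_eq, not_and] at hb2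
        have := hb2 hb.1
        push Not at this
        obtain ⟨a, ha⟩ := this
        exact ⟨a, fun _ => ha⟩
      · exact ⟨0, fun h => absurd h hb⟩
    choose f hf using key
    obtain ⟨c, hc⟩ := hnorm f ⟨_, h, fun a ha => (hf a ha).1⟩
    have := h5 _ _ (h5 _ _ hc h) (hF c)
    apply h3
    convert this
    symm
    rw [Set.eq_empty_iff_forall_notMem]
    rintro x ⟨⟨hx1, hx2⟩, hx3⟩
    have h7 := (hf x hx2).2
    rw [hx1.2] at h7
    exact h7 hx3

lemma pk_count (hκ : Cardinal.aleph0 < κ) (hU : IsUltrafilterOn κ U)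
    (hcomp : IsKappaComplete κ U)
    (F : ℕ → Set Ordinal.{0}) (hF : ∀ n, F n ∈ U) :
    ∃ B ∈ U, ∀ n, B ⊆ F n := by
  have hω : Ordinal.omega0.{0} < κ.ord := by
    rw [← Cardinal.ord_aleph0]; exact Cardinal.ord_lt_ord.2 hκ
  classical
  refine ⟨_, hcomp _ hω (fun i => if h : ∃ n : ℕ, i = n then F h.choose else F 0) ?_, ?_⟩
  · intro i _
    split_ifs
    · exact hF _
    · exact hF _
  · intro n x hx
    have h1 := hx.2
    rw [Set.mem_iInter₂] at h1
    have h2 := h1 (n : Ordinal.{0}) (Ordinal.nat_lt_omega0 n)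
    have h : ∃ m : ℕ, (n : Ordinal.{0}) = m := ⟨n, rfl⟩
    rw [dif_pos h] at h2
    have h3 : n = h.choose := by exact_mod_cast h.choose_spec
    rw [← h3] at h2
    exact h2

lemma pk_tail (hκ : Cardinal.aleph0 < κ) (hU : IsUltrafilterOn κ U)
    (hcomp : IsKappaComplete κ U) (hnp : IsNonprincipal U)
    (a : Ordinal.{0}) (ha : a < κ.ord) : {b | b < κ.ord ∧ a < b} ∈ U := by
  obtain ⟨h1, h2, h3, h4, h5, h6⟩ := hU
  have hs : Order.succ a < κ.ord :=
    (Cardinal.isSuccLimit_ord hκ.le).succ_lt ha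
  have h := hcomp _ hs (fun i => {b | b < κ.ord ∧ b ≠ i}) ?_
  · refine h4 _ _ h ?_ (fun b hb => hb.1)
    intro b hb
    refine ⟨hb.1, ?_⟩
    by_contra hab
    have h7 := hb.2
    rw [Set.mem_iInter₂] at h7
    exact (h7 b (Order.lt_succ_iff.2 (not_lt.1 hab))).2 rfl
  · intro i hi
    rcases h6 {b | b < κ.ord ∧ b ≠ i} (fun b hb => hb.1) with h | h
    · exact h
    · exfalso
      apply hnp i
      refine h4 _ _ h ?_ ?_
      · rintro b ⟨hb, hb2⟩
        by_contra hne
        exact hb2 ⟨hb, hne⟩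
      · rintro b rfl
        exact hi.trans hs

lemma pk_above (hκ : Cardinal.aleph0 < κ) (hU : IsUltrafilterOn κ U)
    (hcomp : IsKappaComplete κ U) (hnp : IsNonprincipal U) (B : Set Ordinal.{0}) (hB : B ∈ U)
    (t : Finset Ordinal.{0}) (ht : ∀ x ∈ t, x < κ.ord) : {b ∈ B | ∀ x ∈ t, x < b} ∈ U := by
  classical
  induction t using Finset.induction_on with
  | empty => simpa using hB
  | insert a t _ ih =>
    have h1 := ih (fun x hx => ht x (Finset.mem_insert_of_mem hx))
    have h2 := pk_tail hκ hU hcomp hnp a (ht a (Finset.mem_insert_self _ _))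
    have h3 := hU.2.2.2.2.1 _ _ h1 h2
    refine hU.2.2.2.1 _ _ h3 ?_ (fun b hb => hU.1 _ hB hb.1)
    rintro b ⟨⟨hb, hb1⟩, hb2, hb3⟩
    refine ⟨hb, fun x hx => ?_⟩
    rcases Finset.mem_insert.1 hx with rfl | hx
    · exact hb3
    · exact hb1 x hx

/-- split off the minimum -/
lemma pk_min (t : Finset Ordinal.{0}) (n : ℕ) (ht : t.card = n + 1) :
    ∃ a ∈ t, ∃ t' : Finset Ordinal.{0}, t' ⊆ t ∧ t'.card = n ∧ (∀ x ∈ t', a < x) ∧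
      t = insert a t' := by
  have hne : t.Nonempty := by rw [← Finset.card_pos]; omega
  have hm := t.min'_mem hne
  refine ⟨t.min' hne, hm, t.erase (t.min' hne), Finset.erase_subset _ _, ?_, ?_, ?_⟩
  · rw [Finset.card_erase_of_mem hm]; omega
  · intro x hx
    exact t.min'_lt_of_mem_erase_min' hne hx
  · exact (Finset.insert_erase hm).symm

lemma pk_fin_diag (hU : IsUltrafilterOn κ U) (hnorm : IsNormalOn κ U) (n : ℕ) :
    ∀ F : Finset Ordinal.{0} → Set Ordinal.{0}, (∀ t, F t ∈ U) →
    ∃ B ∈ U, ∀ t : Finset Ordinal.{0}, t.card = n → ↑t ⊆ B →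
      ∀ b ∈ B, (∀ x ∈ t, x < b) → b ∈ F t := by
  induction n with
  | zero =>
    intro F hF
    refine ⟨F ∅, hF _, ?_⟩
    intro t ht _ b hb _
    rw [Finset.card_eq_zero.1 ht]
    exact hb
  | succ n ih =>
    intro F hF
    choose B hB h using fun a : Ordinal.{0} => ih (fun t => F (insert a t)) (fun t => hF _)
    refine ⟨_, pk_diag hU hnorm B hB, ?_⟩
    intro t ht htB b hb hbt
    obtain ⟨a, ha, t', ht', hc, hlt, rfl⟩ := pk_min t n ht
    refine h a t' hc ?_ b (hb.2 a (hbt a ha)) (fun x hx => hbt x (ht' hx))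
    intro x hx
    exact (htB (ht' hx)).2 a (hlt x hx)

lemma pk_homog (hU : IsUltrafilterOn κ U) (hnorm : IsNormalOn κ U) (n : ℕ) :
    ∀ P : Finset Ordinal.{0} → Prop,
    ∃ B ∈ U, ∃ c : Prop, ∀ t : Finset Ordinal.{0}, t.card = n → ↑t ⊆ B → (P t ↔ c) := by
  induction n with
  | zero =>
    intro P
    refine ⟨_, hU.2.1, P ∅, ?_⟩
    intro t ht _
    rw [Finset.card_eq_zero.1 ht]
  | succ n ih =>
    intro P
    choose B hB c h using fun a : Ordinal.{0} => ih (fun t => P (insert a t))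
    have hΔ := pk_diag hU hnorm B hB
    have main : ∀ C ∈ U, ∀ d : Prop, (∀ a ∈ C, (c a ↔ d)) →
        ∃ B ∈ U, ∃ c : Prop, ∀ t : Finset Ordinal.{0}, t.card = n + 1 → ↑t ⊆ B →
          (P t ↔ c) := by
      intro C hC d hd
      refine ⟨_, hU.2.2.2.2.1 _ _ hC hΔ, d, ?_⟩
      intro t ht htB
      obtain ⟨a, ha, t', ht', hc, hlt, rfl⟩ := pk_min t n ht
      rw [← hd a (htB ha).1]
      refine h a t' hc ?_
      intro x hx
      exact (htB (ht' hx)).2.2 a (hlt x hx)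
    rcases hU.2.2.2.2.2 {a | a < κ.ord ∧ c a} (fun b hb => hb.1) with h | h
    · exact main _ h True (fun a ha => iff_true_intro ha.2)
    · exact main _ h False (fun a ha => iff_false_intro fun hc => ha.2 ⟨ha.1, hc⟩)

end PrikryHelpers

/-- for every dense open `D` and condition `p = (s, A)` there are
`B ∈ U` with `B ⊆ A` and `n : ℕ` such that for every `n`-element subset `t` of `B`,
the condition `(s ∪ t, B ∖ (max t + 1))` belongs to `D`. -/
theorem prikry_star_condition (κ : Cardinal.{0}) (U : Set (Set Ordinal.{0}))
    (hκ : Cardinal.aleph0 < κ)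
    (hU : IsUltrafilterOn κ U) (hcomp : IsKappaComplete κ U)
    (hnorm : IsNormalOn κ U) (hnp : IsNonprincipal U)
    (D : Set PCond) (hD : PDenseOpen κ U D)
    (p : PCond) (hp : PIsCond κ U p) :
    ∃ B ∈ U, B ⊆ p.A ∧ ∃ n : ℕ,
      ∀ t : Finset Ordinal.{0}, t.card = n → ↑t ⊆ B →
        (⟨p.s ∪ t, {b ∈ B | ∀ x ∈ t, x < b}⟩ : PCond) ∈ D := by
  classical
  obtain ⟨hD1, hD2, hD3⟩ := hD
  obtain ⟨hp1, hp2, hp3⟩ := hp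
  have hint := hU.2.2.2.2.1
  have hF : ∀ t : Finset Ordinal.{0}, ∃ A ∈ U,
      (∃ A' , (⟨p.s ∪ t, A'⟩ : PCond) ∈ D) → (⟨p.s ∪ t, A⟩ : PCond) ∈ D := by
    intro t
    by_cases h : ∃ A' , (⟨p.s ∪ t, A'⟩ : PCond) ∈ D
    · obtain ⟨A', hA'⟩ := h
      exact ⟨A', (hD1 _ hA').2.1, fun _ => hA'⟩
    · exact ⟨_, hU.2.1, fun h' => absurd h' h⟩
  choose F hFU hF using hF
  choose G hGU hG using fun n => pk_fin_diag hU hnorm n F hFU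
  choose H hHU c hH using fun n => pk_homog hU hnorm n
    (fun t => ∃ A' , (⟨p.s ∪ t, A'⟩ : PCond) ∈ D)
  obtain ⟨G', hG'U, hG'⟩ := pk_count hκ hU hcomp G hGU
  obtain ⟨H', hH'U, hH'⟩ := pk_count hκ hU hcomp H hHU
  have hB := hint _ _ hp2 (hint _ _ hG'U hH'U)
  refine ⟨_, hB, fun x hx => hx.1, ?_⟩
  obtain ⟨q, hqD, hq1, hq2, hq3⟩ := hD2 ⟨p.s, p.A ∩ (G' ∩ H')⟩ ⟨hp1, hB, fun x hx a ha => hp3 x hx a ha.1⟩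
  refine ⟨(q.s \ p.s).card, ?_⟩
  intro t ht htB
  have hgood : ∃ A' , (⟨p.s ∪ t, A'⟩ : PCond) ∈ D := by
    refine (hH _ t ht fun x hx => hH' _ (htB hx).2.2).2 ?_
    refine (hH _ (q.s \ p.s) rfl ?_).1 ⟨q.A, ?_⟩
    · intro x hx
      have hx' := Finset.mem_sdiff.1 (Finset.mem_coe.1 hx)
      exact hH' _ (hq3 x hx'.1 hx'.2).2.2
    · rw [Finset.union_sdiff_of_subset hq1]
      exact hqD
  have htκ : ∀ x ∈ t, x < κ.ord := fun x hx => hU.1 _ hB (htB hx)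
  refine hD3 _ (hF t hgood) _ ⟨?_, pk_above hκ hU hcomp hnp _ hB t htκ, ?_⟩ ⟨?_, ?_, ?_⟩
  · intro x hx
    rcases Finset.mem_union.1 (Finset.mem_coe.1 hx) with h | h
    · exact hp1 h
    · exact htκ x h
  · intro x hx a ha
    rcases Finset.mem_union.1 hx with h | h
    · exact hp3 x h a ha.1.1
    · exact ha.2 x h
  · exact Finset.Subset.refl _
  · intro b hb
    exact hG _ t ht (fun x hx => hG' _ (htB hx).2.1) b (hG' _ hb.1.2.1) hb.2
  · intro x hx hx'
    exact absurd hx hx'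
end

section
/- Let κ be a measurable cardinal and U a normal κ-complete nonprincipal ultrafilter on κ. Then the Prikry forcing ℙ on κ, equipped with the length function l((s, A)) = |s|, is κ-geometric. -/
/-- A filter on the Prikry poset: a nonempty, upward closed subset of the set of
conditions, any two of whose elements have a common lower bound in it. -/
def PIsFilter (κ : Cardinal.{0}) (U : Set (Set Ordinal.{0})) (F : Set PCond) : Prop :=
  F.Nonempty ∧ (∀ p ∈ F, PIsCond κ U p) ∧
  (∀ p ∈ F, ∀ q, PIsCond κ U q → PExt p q → q ∈ F) ∧
  (∀ p ∈ F, ∀ q ∈ F, ∃ r ∈ F, PExt r p ∧ PExt r q)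


open Filter in
theorem aux_vf {κ : Cardinal.{0}} {U : Set (Set Ordinal.{0})} (hU : IsUltrafilterOn κ U) :
    ∃ V : Ultrafilter Ordinal.{0}, ∀ S : Set Ordinal.{0}, S ∈ V ↔ S ∩ Set.Iio κ.ord ∈ U := by
  obtain ⟨h1, h2, h3, h4, h5, h6⟩ := hU
  let f : Filter Ordinal.{0} :=
    { sets := {S | S ∩ Set.Iio κ.ord ∈ U}
      univ_sets := by simpa using h2
      sets_of_superset := by
        intro x y hx hxy
        exact h4 _ _ hx (Set.inter_subset_inter_left _ hxy) Set.inter_subset_right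
      inter_sets := by
        intro x y hx hy
        have := h5 _ _ hx hy
        rwa [← Set.inter_inter_distrib_right] at this }
  have hf : ∀ S, S ∈ f ↔ S ∩ Set.Iio κ.ord ∈ U := fun S => Iff.rfl
  refine ⟨Ultrafilter.ofComplNotMemIff f ?_, hf⟩
  intro S
  rw [hf, hf]
  have e : Set.Iio κ.ord \ (S ∩ Set.Iio κ.ord) = Sᶜ ∩ Set.Iio κ.ord := by
    ext x; simp; tauto
  constructor
  · intro h
    rcases h6 (S ∩ Set.Iio κ.ord) Set.inter_subset_right with h' | h'
    · exact h'
    · rw [e] at h'; exact absurd h' h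
  · intro h h'
    apply h3
    have := h5 _ _ h h'
    convert this using 1
    ext x; simp; tauto

/-- The iterated derivative of stems. -/
def auxG (V : Ultrafilter Ordinal.{0}) (D : Set PCond) : ℕ → Set (Finset Ordinal.{0})
  | 0 => {s | ∃ A, (⟨s, A⟩ : PCond) ∈ D}
  | n + 1 => {s | ∀ᶠ α in (V : Filter Ordinal.{0}), insert α s ∈ auxG V D n}

section
open Filter
variable {V : Ultrafilter Ordinal.{0}}

theorem aux_nat (hN : ∀ f : Ordinal.{0} → Ordinal.{0}, (∀ᶠ α in (V : Filter Ordinal.{0}), f α < α) →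
      ∃ c, ∀ᶠ α in (V : Filter Ordinal.{0}), f α = c)
    (hω : ∀ᶠ α in (V : Filter Ordinal.{0}), Ordinal.omega0 < α) (g : Ordinal.{0} → ℕ) :
    ∃ n, ∀ᶠ α in (V : Filter Ordinal.{0}), g α = n := by
  obtain ⟨c, hc⟩ := hN (fun α => (g α : Ordinal.{0}))
    (hω.mono fun α h => (Ordinal.natCast_lt_omega0 _).trans h)
  obtain ⟨a, ha⟩ := hc.exists
  refine ⟨g a, hc.mono fun α h => ?_⟩
  rw [← ha] at h
  exact_mod_cast h

theorem aux_fin (hN : ∀ f : Ordinal.{0} → Ordinal.{0}, (∀ᶠ α in (V : Filter Ordinal.{0}), f α < α) →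
      ∃ c, ∀ᶠ α in (V : Filter Ordinal.{0}), f α = c) (n : ℕ) :
    ∀ g : Ordinal.{0} → Finset Ordinal.{0}, (∀ᶠ α in (V : Filter Ordinal.{0}), (g α).card = n) →
      (∀ᶠ α in (V : Filter Ordinal.{0}), ∀ x ∈ g α, x < α) →
      ∃ s, ∀ᶠ α in (V : Filter Ordinal.{0}), g α = s := by
  induction n with
  | zero =>
    intro g h _
    exact ⟨∅, h.mono fun α h => Finset.card_eq_zero.1 h⟩
  | succ n ih =>
    intro g h h'
    have key : ∀ α, ∃ c, (g α).card = n + 1 → c ∈ g α := by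
      intro α
      by_cases hh : (g α).Nonempty
      · obtain ⟨c, hc⟩ := hh
        exact ⟨c, fun _ => hc⟩
      · refine ⟨0, fun h => ?_⟩
        rw [Finset.not_nonempty_iff_eq_empty] at hh
        simp [hh] at h
    choose m hm using key
    obtain ⟨c, hc⟩ := hN m (by filter_upwards [h, h'] with α h1 h2 using h2 _ (hm _ h1))
    obtain ⟨s, hs⟩ := ih (fun α => (g α).erase c)
      (by
        filter_upwards [h, hc] with α h1 h2
        rw [Finset.card_erase_of_mem (h2 ▸ hm _ h1), h1]; rfl)
      (h'.mono fun α h x hx => h x (Finset.mem_of_mem_erase hx))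
    refine ⟨insert c s, ?_⟩
    filter_upwards [h, hc, hs] with α h1 h2 h3
    rw [← h3, Finset.insert_erase (h2 ▸ hm _ h1)]

theorem aux_diag (hN : ∀ f : Ordinal.{0} → Ordinal.{0}, (∀ᶠ α in (V : Filter Ordinal.{0}), f α < α) →
      ∃ c, ∀ᶠ α in (V : Filter Ordinal.{0}), f α = c)
    (hω : ∀ᶠ α in (V : Filter Ordinal.{0}), Ordinal.omega0 < α)
    (C : Finset Ordinal.{0} → Ordinal.{0} → Prop)
    (hC : ∀ s, ∀ᶠ α in (V : Filter Ordinal.{0}), C s α) :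
    ∀ᶠ α in (V : Filter Ordinal.{0}), ∀ s : Finset Ordinal.{0}, (∀ x ∈ s, x < α) → C s α := by
  by_contra hcon
  rw [← Ultrafilter.eventually_not] at hcon
  have key : ∀ α, ∃ s : Finset Ordinal.{0},
      (¬ ∀ s : Finset Ordinal.{0}, (∀ x ∈ s, x < α) → C s α) →
      (∀ x ∈ s, x < α) ∧ ¬ C s α := by
    intro α
    by_cases h : ∀ s : Finset Ordinal.{0}, (∀ x ∈ s, x < α) → C s α
    · exact ⟨∅, fun h' => absurd h h'⟩
    · push Not at h
      obtain ⟨s, hs⟩ := h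
      exact ⟨s, fun _ => hs⟩
  choose g hg using key
  obtain ⟨n, hn⟩ := aux_nat hN hω (fun α => (g α).card)
  obtain ⟨s, hs⟩ := aux_fin hN n g hn (hcon.mono fun α h => (hg α h).1)
  obtain ⟨α, h1, h2, h3⟩ := (hcon.and (hs.and (hC s))).exists
  exact (hg α h1).2 (h2 ▸ h3)

theorem aux_step {P : ℕ → Finset Ordinal.{0} → Prop} {X : Set Ordinal.{0}}
    (hstep : ∀ k s α, α ∈ X → (∀ x ∈ s, x < α) → P k s → P (k + 1) (insert α s))
    {s : Finset Ordinal.{0}} (hs : P 0 s) (u : Finset Ordinal.{0}) :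
    (∀ y ∈ u, y ∈ X) → (∀ x ∈ s, ∀ y ∈ u, x < y) → P u.card (s ∪ u) := by
  induction u using Finset.induction_on_max with
  | empty => intro _ _; simpa using hs
  | insert a u ha ih =>
    intro h1 h2
    rw [Finset.union_insert, Finset.card_insert_of_notMem (fun h => lt_irrefl _ (ha a h))]
    apply hstep
    · exact h1 a (by simp)
    · intro x hx
      rcases Finset.mem_union.1 hx with hx | hx
      · exact h2 x hx a (by simp)
      · exact ha x hx
    · exact ih (fun y hy => h1 y (by simp [hy])) (fun x hx y hy => h2 x hx y (by simp [hy]))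

theorem aux_main {κ : Cardinal.{0}} {U : Set (Set Ordinal.{0})}
    (hV : ∀ S : Set Ordinal.{0}, S ∈ V ↔ S ∩ Set.Iio κ.ord ∈ U)
    (hUs : ∀ A ∈ U, A ⊆ Set.Iio κ.ord)
    (hN : ∀ f : Ordinal.{0} → Ordinal.{0}, (∀ᶠ α in (V : Filter Ordinal.{0}), f α < α) →
      ∃ c, ∀ᶠ α in (V : Filter Ordinal.{0}), f α = c)
    (hω : ∀ᶠ α in (V : Filter Ordinal.{0}), Ordinal.omega0 < α)
    (hb : ∀ c < κ.ord, ∀ᶠ α in (V : Filter Ordinal.{0}), c < α)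
    {D : Set PCond} (hD : PDenseOpen κ U D) (p : PCond) (hp : PIsCond κ U p) :
    ∃ X ∈ U, ∃ n : ℕ, ∀ r, PIsCond κ U r → PExt r p → PExt r ⟨p.s, X⟩ →
      p.s.card + n ≤ r.s.card → r ∈ D := by
  obtain ⟨hD1, hD2, hD3⟩ := hD
  have hVU : ∀ A ∈ U, A ∈ V := fun A hA => by
    rw [hV, Set.inter_eq_left.2 (hUs A hA)]; exact hA
  have hκ : ∀ᶠ α in (V : Filter Ordinal.{0}), α < κ.ord := by
    have : Set.Iio κ.ord ∈ V := by
      have := (hV Set.univ).1 univ_mem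
      rw [hV]; simpa using this
    exact this
  have habove : ∀ s : Finset Ordinal.{0}, (↑s : Set Ordinal.{0}) ⊆ Set.Iio κ.ord →
      ∀ᶠ α in (V : Filter Ordinal.{0}), ∀ x ∈ s, x < α := by
    intro s hs
    rw [Filter.eventually_all_finset]
    intro x hx
    exact hb x (hs hx)
  have hG : ∀ s : Finset Ordinal.{0}, (↑s : Set Ordinal.{0}) ⊆ Set.Iio κ.ord →
      ∃ n, s ∈ auxG V D n := by
    intro s hs
    by_contra hsn
    have hC : ∀ t : Finset Ordinal.{0}, ∀ᶠ α in (V : Filter Ordinal.{0}),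
        (¬ ∃ n, t ∈ auxG V D n) → ¬ ∃ n, insert α t ∈ auxG V D n := by
      intro t
      by_cases ht : ∃ n, t ∈ auxG V D n
      · exact Eventually.of_forall fun α h => absurd ht h
      · suffices h : ∀ᶠ α in (V : Filter Ordinal.{0}), ¬ ∃ n, insert α t ∈ auxG V D n from
          h.mono fun α h _ => h
        rw [Ultrafilter.eventually_not]
        intro hcon
        classical
        obtain ⟨n, hn⟩ := aux_nat hN hω
          (fun α => sInf {n | insert α t ∈ auxG V D n})
        apply ht
        refine ⟨n + 1, ?_⟩
        show ∀ᶠ α in (V : Filter Ordinal.{0}), insert α t ∈ auxG V D n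
        filter_upwards [hcon, hn] with α h1 h2
        rw [← h2]
        exact Nat.sInf_mem (s := {n | insert α t ∈ auxG V D n}) h1
    have hX := aux_diag hN hω _ hC
    have hY := hX.and (habove s hs)
    obtain ⟨q, hqD, hq1, hq2, hq3⟩ := hD2 ⟨s, _ ∩ Set.Iio κ.ord⟩
      ⟨hs, (hV _).1 hY, fun x hx a ha => ha.1.2 x hx⟩
    have := aux_step (P := fun _ t => ¬ ∃ n, t ∈ auxG V D n) (X := {α | ∀ s : Finset Ordinal.{0}, (∀ x ∈ s, x < α) → (¬ ∃ n, s ∈ auxG V D n) → ¬ ∃ n, insert α s ∈ auxG V D n})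
      (fun k t α hα ht hP => hα t ht hP) hsn (q.s \ s)
      (fun y hy => (hq3 y (Finset.mem_sdiff.1 hy).1 (Finset.mem_sdiff.1 hy).2).1.1)
      (fun x hx y hy => (hq3 y (Finset.mem_sdiff.1 hy).1 (Finset.mem_sdiff.1 hy).2).1.2 x hx)
    apply this
    refine ⟨0, q.A, ?_⟩
    rw [Finset.union_sdiff_of_subset hq1]
    exact hqD
  have hA : ∀ s : Finset Ordinal.{0}, ∃ A : Set Ordinal.{0}, s ∈ auxG V D 0 →
      (⟨s, A⟩ : PCond) ∈ D := by
    intro s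
    by_cases h : s ∈ auxG V D 0
    · obtain ⟨A, hA⟩ := h
      exact ⟨A, fun _ => hA⟩
    · exact ⟨∅, fun h' => absurd h' h⟩
  choose A hA using hA
  let ρ : Finset Ordinal.{0} → ℕ := fun s => sInf {n | s ∈ auxG V D n}
  have hρ : ∀ s : Finset Ordinal.{0}, (↑s : Set Ordinal.{0}) ⊆ Set.Iio κ.ord →
      s ∈ auxG V D (ρ s) := fun s hs => Nat.sInf_mem (s := {n | s ∈ auxG V D n}) (hG s hs)
  have hρle : ∀ s n, s ∈ auxG V D n → ρ s ≤ n := fun s n h =>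
    Nat.sInf_le (s := {n | s ∈ auxG V D n}) h
  have hC : ∀ t : Finset Ordinal.{0}, ∀ᶠ α in (V : Filter Ordinal.{0}),
      (↑t : Set Ordinal.{0}) ⊆ Set.Iio κ.ord →
        ρ (insert α t) ≤ ρ t - 1 ∧ (t ∈ auxG V D 0 → α ∈ A t) := by
    intro t
    by_cases ht : (↑t : Set Ordinal.{0}) ⊆ Set.Iio κ.ord
    swap
    · exact Eventually.of_forall fun α h => absurd h ht
    have hAt : ∀ᶠ α in (V : Filter Ordinal.{0}), t ∈ auxG V D 0 → α ∈ A t := by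
      by_cases h : t ∈ auxG V D 0
      · have : A t ∈ V := hVU _ (hD1 _ (hA t h)).2.1
        filter_upwards [this] with α hα _ using hα
      · exact Eventually.of_forall fun α h' => absurd h' h
    have hr : ∀ᶠ α in (V : Filter Ordinal.{0}), ρ (insert α t) ≤ ρ t - 1 := by
      have h0 := hρ t ht
      rcases hk : ρ t with _ | m
      · rw [hk] at h0
        filter_upwards [hAt, hκ, habove t ht] with α h1 h2 h3
        apply hρle
        obtain ⟨c1, c2, c3⟩ := hD1 _ (hA t h0)
        have hU' : A t ∩ {β | α < β} ∩ Set.Iio κ.ord ∈ U :=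
          (hV _).1 (inter_mem (hVU _ c2) (hb α h2))
        refine ⟨A t ∩ {β | α < β} ∩ Set.Iio κ.ord, hD3 _ (hA t h0) _ ⟨?_, hU', ?_⟩ ⟨?_, ?_, ?_⟩⟩
        · intro x hx
          rcases Finset.mem_insert.1 (Finset.mem_coe.1 hx) with rfl | hx
          · exact h2
          · exact ht hx
        · intro x hx a ha
          rcases Finset.mem_insert.1 hx with rfl | hx
          · exact ha.1.2
          · exact c3 x hx a ha.1.1
        · exact Finset.subset_insert _ _
        · exact fun x hx => hx.1.1
        · intro x hx hxt
          rcases Finset.mem_insert.1 hx with rfl | hx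
          · exact h1 h0
          · exact absurd hx hxt
      · rw [hk] at h0
        exact Filter.Eventually.mono h0 fun α h => hρle _ _ h
    filter_upwards [hAt, hr] with α h1 h2 _ using ⟨h2, h1⟩
  have hX := aux_diag hN hω _ hC
  refine ⟨_, (hV _).1 hX, ρ p.s, ?_⟩
  intro r hr hrp hrX hcard
  have hsub : p.s ⊆ r.s := hrX.1
  have hrX3 := hrX.2.2
  have hstep := aux_step (P := fun k t => (↑t : Set Ordinal.{0}) ⊆ Set.Iio κ.ord ∧ ρ t ≤ ρ p.s - k)
      (X := _ ∩ Set.Iio κ.ord)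
      (fun k t α hα ht hP => by
        have := hα.1 t ht hP.1
        refine ⟨?_, ?_⟩
        · intro x hx
          rcases Finset.mem_insert.1 (Finset.mem_coe.1 hx) with rfl | hx
          · exact hα.2
          · exact hP.1 hx
        · have h1 := this.1
          have h2 := hP.2
          omega) (s := p.s) ⟨hp.1, by simp⟩ (r.s \ p.s)
      (fun y hy => hrX3 y (Finset.mem_sdiff.1 hy).1 (Finset.mem_sdiff.1 hy).2)
      (fun x hx y hy => hp.2.2 x hx y
        (hrp.2.2 y (Finset.mem_sdiff.1 hy).1 (Finset.mem_sdiff.1 hy).2))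
  rw [Finset.union_sdiff_of_subset hsub, Finset.card_sdiff_of_subset hsub] at hstep
  have h0 : ρ r.s = 0 := by have := hstep.2; omega
  have hr0 : r.s ∈ auxG V D 0 := h0 ▸ hρ r.s hr.1
  refine hD3 _ (hA _ hr0) r hr ⟨Finset.Subset.refl _, ?_, fun x hx hx' => absurd hx hx'⟩
  intro a ha
  exact ((hrX.2.1 ha).1 r.s (fun x hx => hr.2.2 x hx a ha) hr.1).2 hr0

end

/-- Prikry forcing on `κ`, with the length function `l (s,A) = |s|`,
is κ-geometric: for every `γ < κ` and every family `⟨D β : β < γ⟩` of dense open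
sets, every condition `p` has an extension `q` such that every filter containing
`q` and meeting each `E n = {r : l r > n}` also meets each `D β`. -/
theorem prikry_kappa_geometric (κ : Cardinal.{0}) (U : Set (Set Ordinal.{0}))
    (hκ : Cardinal.aleph0 < κ)
    (hU : IsUltrafilterOn κ U) (hcomp : IsKappaComplete κ U)
    (hnorm : IsNormalOn κ U) (hnp : IsNonprincipal U) :
    ∀ γ < κ.ord, ∀ D : Ordinal.{0} → Set PCond,
      (∀ β < γ, PDenseOpen κ U (D β)) →
      ∀ p, PIsCond κ U p →
        ∃ q, PIsCond κ U q ∧ PExt q p ∧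
          ∀ F : Set PCond, PIsFilter κ U F → q ∈ F →
            (∀ n : ℕ, ∃ r ∈ F, n < r.s.card) →
            ∀ β < γ, ∃ r ∈ F, r ∈ D β := by
  intro γ hγ D hD p hp
  obtain ⟨V, hV⟩ := aux_vf hU
  have hUs := hU.1
  have hN : ∀ f : Ordinal.{0} → Ordinal.{0},
      (∀ᶠ α in (V : Filter Ordinal.{0}), f α < α) →
      ∃ c, ∀ᶠ α in (V : Filter Ordinal.{0}), f α = c := by
    intro f hf
    obtain ⟨c, hc⟩ := hnorm f ⟨_, (hV _).1 hf, fun α hα => hα.1⟩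
    refine ⟨c, (hV _).2 ?_⟩
    convert hc using 1
    ext x; simp [and_comm]
  have hb : ∀ c < κ.ord, ∀ᶠ α in (V : Filter Ordinal.{0}), c < α := by
    intro c hc
    have hlim : Order.succ c < κ.ord := (Cardinal.isSuccLimit_ord hκ.le).succ_lt hc
    have := hcomp (Order.succ c) hlim (fun i => Set.Iio κ.ord \ {i}) (by
      intro i hi
      have hi' : i < κ.ord := hi.trans hlim
      rcases hU.2.2.2.2.2 {i} (by simpa using hi') with h | h
      · exact absurd h (hnp i)
      · exact h)
    refine (hV _).2 (hU.2.2.2.1 _ _ this ?_ Set.inter_subset_right)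
    rintro x ⟨hx, hx'⟩
    refine ⟨?_, hx⟩
    by_contra hcx
    have hxc : x ≤ c := not_lt.1 hcx
    have := Set.mem_iInter₂.1 hx' x (Order.lt_succ_iff.2 hxc)
    exact this.2 rfl
  have hω : ∀ᶠ α in (V : Filter Ordinal.{0}), Ordinal.omega0 < α := by
    apply hb
    rw [← Cardinal.ord_aleph0]
    exact Cardinal.ord_lt_ord.2 hκ
  have key : ∀ β, ∃ X : Set Ordinal.{0}, ∃ n : ℕ, β < γ → X ∈ U ∧
      ∀ r, PIsCond κ U r → PExt r p → PExt r ⟨p.s, X⟩ → p.s.card + n ≤ r.s.card → r ∈ D β := by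
    intro β
    by_cases hβ : β < γ
    · obtain ⟨X, hX, n, h⟩ := aux_main hV hUs hN hω hb (hD β hβ) p hp
      exact ⟨X, n, fun _ => ⟨hX, h⟩⟩
    · exact ⟨∅, 0, fun h => absurd h hβ⟩
  choose X n hXn using key
  have hI := hcomp γ hγ X (fun i hi => (hXn i hi).1)
  refine ⟨⟨p.s, p.A ∩ (Set.Iio κ.ord ∩ ⋂ i ∈ Set.Iio γ, X i)⟩,
    ⟨hp.1, hU.2.2.2.2.1 _ _ hp.2.1 hI, fun x hx a ha => hp.2.2 x hx a ha.1⟩,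
    ⟨Finset.Subset.refl _, Set.inter_subset_left, fun x hx hx' => absurd hx hx'⟩, ?_⟩
  intro F hF hqF hlen β hβ
  obtain ⟨r₁, hr₁, hl⟩ := hlen (p.s.card + n β)
  obtain ⟨r, hrF, hrq, hrr⟩ := hF.2.2.2 _ hqF _ hr₁
  obtain ⟨e1, e2, e3⟩ := hrq
  refine ⟨r, hrF, (hXn β hβ).2 r (hF.2.1 r hrF)
    ⟨e1, fun a ha => (e2 ha).1, fun x hx hx' => (e3 x hx hx').1⟩
    ⟨e1, fun a ha => Set.mem_iInter₂.1 (e2 ha).2.2 β hβ,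
      fun x hx hx' => Set.mem_iInter₂.1 (e3 x hx hx').2.2 β hβ⟩ ?_⟩
  exact hl.le.trans (Finset.card_le_card hrr.1)
end

section
/- Let κ be a measurable cardinal, U a normal κ-complete nonprincipal ultrafilter on κ, and ℙ the Prikry forcing on κ. Then every antichain in ℙ (a set of pairwise incompatible conditions) has cardinality at most κ; that is, ℙ is κ⁺-cc. -/
/-- the Prikry forcing on `κ` is `κ⁺`-cc: every antichain
(set of conditions that are pairwise incompatible, i.e. with no common
extension) has cardinality at most `κ`. -/
theorem prikry_kappa_plus_cc (κ : Cardinal.{0}) (U : Set (Set Ordinal.{0}))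
    (hκ : Cardinal.aleph0 < κ)
    (hU : IsUltrafilterOn κ U) (hcomp : IsKappaComplete κ U)
    (hnorm : IsNormalOn κ U) (hnp : IsNonprincipal U)
    (A : Set PCond) (hA : ∀ p ∈ A, PIsCond κ U p)
    (hanti : ∀ p ∈ A, ∀ q ∈ A, p ≠ q →
      ¬ ∃ r : PCond, PIsCond κ U r ∧ PExt r p ∧ PExt r q) :
    Cardinal.mk ↥A ≤ Cardinal.lift.{1} κ := by
  classical
  have hmk : Cardinal.mk (Set.Iio κ.ord) = Cardinal.lift.{1} κ := by
    rw [Cardinal.mk_Iio_ordinal, Cardinal.card_ord]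
  have : Infinite (Set.Iio κ.ord) := by
    rw [Cardinal.infinite_iff, hmk, Cardinal.aleph0_le_lift]
    exact hκ.le
  rw [← hmk, ← Cardinal.mk_finset_of_infinite (Set.Iio κ.ord)]
  refine Cardinal.mk_le_of_injective
    (f := fun p : A => (p.1.s.subtype (fun x => x ∈ Set.Iio κ.ord))) ?_
  intro p q hpq
  have hp := hA p.1 p.2
  have hq := hA q.1 q.2
  have hs : p.1.s = q.1.s := by
    ext x
    constructor
    · intro hx
      have h : (⟨x, hp.1 hx⟩ : Set.Iio κ.ord) ∈ p.1.s.subtype (fun x => x ∈ Set.Iio κ.ord) :=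
        Finset.mem_subtype.2 hx
      have hpq' : p.1.s.subtype (fun x => x ∈ Set.Iio κ.ord)
        = q.1.s.subtype (fun x => x ∈ Set.Iio κ.ord) := hpq
      rw [hpq'] at h
      exact Finset.mem_subtype.1 h
    · intro hx
      have h : (⟨x, hq.1 hx⟩ : Set.Iio κ.ord) ∈ q.1.s.subtype (fun x => x ∈ Set.Iio κ.ord) :=
        Finset.mem_subtype.2 hx
      have hpq' : p.1.s.subtype (fun x => x ∈ Set.Iio κ.ord)
        = q.1.s.subtype (fun x => x ∈ Set.Iio κ.ord) := hpq
      rw [← hpq'] at h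
      exact Finset.mem_subtype.1 h
  by_contra hne
  refine hanti p.1 p.2 q.1 q.2 (fun h => hne (Subtype.ext h))
    ⟨⟨p.1.s, p.1.A ∩ q.1.A⟩, ⟨hp.1, hU.2.2.2.2.1 _ _ hp.2.1 hq.2.1, ?_⟩, ?_, ?_⟩
  · intro x hx a ha
    exact hp.2.2 x hx a ha.1
  · exact ⟨fun _ h => h, fun _ h => h.1, fun x hx hn => absurd hx hn⟩
  · exact ⟨fun x h => hs ▸ h, fun _ h => h.2, fun x hx hn => absurd (hs ▸ hx) hn⟩
end

section
/- Let κ be a measurable cardinal and U a κ-complete nonprincipal ultrafilter on κ. Then the tree Prikry forcing ℙ on κ satisfies the *-Prikry condition: for every condition p ∈ ℙ and every dense open subset D of ℙ, there exist a natural number n and a direct extension q ≤* p such that every r ≤ q with l(r) = l(q) + n belongs to D. -/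
/-- A condition of the tree Prikry forcing on `κ`: a finite sequence (stem) `s`
of ordinals and a tree `T` of finite sequences of ordinals. -/
structure TCond : Type 1 where
  s : List Ordinal.{0}
  T : Set (List Ordinal.{0})

/-- `p = (s, T)` is a condition of the tree Prikry forcing on `κ` with
ultrafilter `U`: `s` is a finite strictly increasing sequence of ordinals below
`κ`; `T` is a set of finite strictly increasing sequences of ordinals below `κ`,
closed under initial segments, whose every element is comparable with the stem
`s` (an initial segment of `s` or an end-extension of `s`), containing `s`, and
such that for every `t ∈ T` end-extending `s`, the set of one-point extensions
`Suc_T t = {β : t ++ [β] ∈ T}` belongs to `U`. -/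
def TIsCond (κ : Cardinal.{0}) (U : Set (Set Ordinal.{0})) (p : TCond) : Prop :=
  (∀ x ∈ p.s, x < κ.ord) ∧ p.s.Chain' (· < ·) ∧
  p.s ∈ p.T ∧
  (∀ t ∈ p.T, (∀ x ∈ t, x < κ.ord) ∧ t.Chain' (· < ·)) ∧
  (∀ t ∈ p.T, t <+: p.s ∨ p.s <+: t) ∧
  (∀ t u : List Ordinal.{0}, u ∈ p.T → t <+: u → t ∈ p.T) ∧
  (∀ t ∈ p.T, p.s <+: t → {β : Ordinal.{0} | t ++ [β] ∈ p.T} ∈ U)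

/-- `p ≤ q`: `p` extends `q`, i.e. the stem of `p` end-extends the stem of `q`
and `T^p ⊆ T^q`. -/
def TExt (p q : TCond) : Prop := q.s <+: p.s ∧ p.T ⊆ q.T

/-- `p ≤* q`: `p` is a direct extension of `q`. -/
def TDirExt (p q : TCond) : Prop := TExt p q ∧ p.s = q.s

/-- `D` is a dense open subset of the tree Prikry forcing. -/
def TDenseOpen (κ : Cardinal.{0}) (U : Set (Set Ordinal.{0})) (D : Set TCond) : Prop :=
  (∀ p ∈ D, TIsCond κ U p) ∧
  (∀ p, TIsCond κ U p → ∃ q ∈ D, TExt q p) ∧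
  (∀ p ∈ D, ∀ q, TIsCond κ U q → TExt q p → q ∈ D)

/-- `t` is good of rank `n`. -/
def TGood (U : Set (Set Ordinal.{0})) (p : TCond) (D : Set TCond) :
    ℕ → List Ordinal.{0} → Prop
  | 0, t => ∃ q ∈ D, q.s = t ∧ q.T ⊆ p.T
  | (n+1), t => {β : Ordinal.{0} | t ++ [β] ∈ p.T ∧ TGood U p D n (t ++ [β])} ∈ U

theorem tgood_exists (κ : Cardinal.{0}) (U : Set (Set Ordinal.{0}))
    (hκ : Cardinal.aleph0 < κ)
    (hU : IsUltrafilterOn κ U) (hcomp : IsKappaComplete κ U)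
    (p : TCond) (hp : TIsCond κ U p)
    (D : Set TCond) (hD : TDenseOpen κ U D) : ∃ n, TGood U p D n p.s := by
  by_contra hcon
  obtain ⟨hUsub, hUuniv, hUemp, hUup, hUint, hUult⟩ := hU
  obtain ⟨hp1, hp2, hp3, hp4, hp5, hp6, hp7⟩ := hp
  have key : ∀ t ∈ p.T, p.s <+: t → (¬ ∃ n, TGood U p D n t) →
      {β : Ordinal.{0} | t ++ [β] ∈ p.T ∧ ¬ ∃ n, TGood U p D n (t ++ [β])} ∈ U := by
    intro t ht hst hbad
    have hω : Ordinal.omega0 < κ.ord := by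
      rw [← Cardinal.ord_aleph0]
      exact Cardinal.ord_lt_ord.2 hκ
    have h1 := hcomp Ordinal.omega0 hω
      (fun i => {β | β < κ.ord ∧ ∀ n : ℕ, i = n →
        ¬ (t ++ [β] ∈ p.T ∧ TGood U p D n (t ++ [β]))}) (by
      intro i hi
      obtain ⟨n, rfl⟩ := Ordinal.lt_omega0.1 hi
      rcases hUult {β : Ordinal.{0} | t ++ [β] ∈ p.T ∧ TGood U p D n (t ++ [β])}
        (fun β hβ => (hp4 _ hβ.1).1 β (by simp)) with h | h
      · exact absurd ⟨n+1, h⟩ hbad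
      · refine hUup _ _ h ?_ (fun β hβ => hβ.1)
        rintro β ⟨hβ, hβ'⟩
        refine ⟨hβ, ?_⟩
        intro m hm
        have : n = m := by exact_mod_cast hm
        subst this
        exact hβ')
    refine hUup _ _ (hUint _ _ h1 (hp7 t ht hst)) ?_
      (fun β hβ => (hp4 _ hβ.1).1 β (by simp))
    rintro β ⟨⟨_, hβ⟩, hβT⟩
    refine ⟨hβT, ?_⟩
    rintro ⟨n, hn⟩
    have := Set.mem_iInter₂.1 hβ (n : Ordinal) (Ordinal.natCast_lt_omega0 n)
    exact this.2 n rfl ⟨hβT, hn⟩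
  obtain ⟨q, hqD, hq1, hq2⟩ := hD.2.1
    ⟨p.s, {u | u ∈ p.T ∧ ∀ v, p.s <+: v → v <+: u → ¬ ∃ n, TGood U p D n v}⟩ (by
    refine ⟨hp1, hp2, ⟨hp3, ?_⟩, fun t ht => hp4 t ht.1, fun t ht => hp5 t ht.1, ?_, ?_⟩
    · intro v h1 h2
      have : v = p.s := h2.eq_of_length (le_antisymm h2.length_le h1.length_le)
      rw [this]; exact hcon
    · intro t u hu htu
      exact ⟨hp6 t u hu.1 htu, fun v h1 h2 => hu.2 v h1 (h2.trans htu)⟩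
    · intro t ht hst
      refine hUup _ _ (key t ht.1 hst (ht.2 t hst List.prefix_rfl)) ?_
        (fun β hβ => (hp4 _ hβ.1).1 β (by simp))
      intro β hβ
      refine ⟨hβ.1, ?_⟩
      intro v h1 h2
      rcases List.prefix_concat_iff.1 h2 with h | h
      · rw [h]; exact hβ.2
      · exact ht.2 v h1 h)
  have hqc := hD.1 q hqD
  exact (hq2 hqc.2.2.1).2 q.s hq1 List.prefix_rfl ⟨0, q, hqD, rfl, fun u hu => (hq2 hu).1⟩

theorem tgood_spec (κ : Cardinal.{0}) (U : Set (Set Ordinal.{0}))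
    (hU : IsUltrafilterOn κ U)
    (p : TCond) (hp : TIsCond κ U p)
    (D : Set TCond) (hD : TDenseOpen κ U D) (n : ℕ) :
    ∀ t ∈ p.T, TGood U p D n t →
    ∃ q : TCond, TIsCond κ U q ∧ q.s = t ∧ q.T ⊆ p.T ∧
      ∀ r : TCond, TIsCond κ U r → TExt r q →
        r.s.length = q.s.length + n → r ∈ D := by
  obtain ⟨hUsub, hUuniv, hUemp, hUup, hUint, hUult⟩ := hU
  obtain ⟨hp1, hp2, hp3, hp4, hp5, hp6, hp7⟩ := hp
  induction n with
  | zero =>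
    rintro t ht ⟨q, hqD, hqs, hqT⟩
    exact ⟨q, hD.1 q hqD, hqs, hqT, fun r hr hrq _ => hD.2.2 q hqD r hr hrq⟩
  | succ n ih =>
    intro t ht hg
    have hg' : {β : Ordinal.{0} | t ++ [β] ∈ p.T ∧ TGood U p D n (t ++ [β])} ∈ U := hg
    set A := {β : Ordinal.{0} | t ++ [β] ∈ p.T ∧ TGood U p D n (t ++ [β])} with hA
    have hex : ∀ β, ∃ q : TCond, β ∈ A → (TIsCond κ U q ∧ q.s = t ++ [β] ∧ q.T ⊆ p.T ∧
      ∀ r : TCond, TIsCond κ U r → TExt r q →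
        r.s.length = q.s.length + n → r ∈ D) := by
      intro β
      by_cases hβ : β ∈ A
      · obtain ⟨q, hq⟩ := ih _ hβ.1 hβ.2
        exact ⟨q, fun _ => hq⟩
      · exact ⟨p, fun h => absurd h hβ⟩
    choose Q hQ using hex
    have hsub : ∀ u, (u <+: t ∨ ∃ β ∈ A, t ++ [β] <+: u ∧ u ∈ (Q β).T) → u ∈ p.T := by
      rintro u (h | ⟨β, hβ, _, h⟩)
      · exact hp6 _ _ ht h
      · exact (hQ β hβ).2.2.1 h
    refine ⟨⟨t, {u | u <+: t ∨ ∃ β ∈ A, t ++ [β] <+: u ∧ u ∈ (Q β).T}⟩, ?_, rfl, hsub, ?_⟩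
    · refine ⟨(hp4 t ht).1, (hp4 t ht).2, Or.inl List.prefix_rfl,
        fun u hu => hp4 u (hsub u hu), ?_, ?_, ?_⟩
      · rintro u (h | ⟨β, hβ, h, _⟩)
        · exact Or.inl h
        · exact Or.inr ((List.prefix_append _ _).trans h)
      · rintro u v (h | ⟨β, hβ, h, hv⟩) huv
        · exact Or.inl (huv.trans h)
        · rcases List.prefix_or_prefix_of_prefix huv h with h' | h'
          · rcases List.prefix_concat_iff.1 h' with h'' | h''
            · exact Or.inr ⟨β, hβ, by rw [h''], (hQ β hβ).1.2.2.2.2.2.1 _ _ hv huv⟩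
            · exact Or.inl h''
          · exact Or.inr ⟨β, hβ, h', (hQ β hβ).1.2.2.2.2.2.1 _ _ hv huv⟩
      · rintro u hu htu
        rcases hu with h | ⟨β, hβ, h, hu⟩
        · have : u = t := h.eq_of_length (le_antisymm h.length_le htu.length_le)
          subst this
          refine hUup _ _ hg' ?_ (fun β hβ => (hp4 _ (hsub _ hβ)).1 β (by simp))
          intro β hβ
          refine Or.inr ⟨β, hβ, List.prefix_rfl, ?_⟩
          have := (hQ β hβ).1.2.2.1
          rwa [(hQ β hβ).2.1] at this
        · refine hUup _ _ ((hQ β hβ).1.2.2.2.2.2.2 u hu (by rw [(hQ β hβ).2.1]; exact h)) ?_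
            (fun β hβ => (hp4 _ (hsub _ hβ)).1 β (by simp))
          intro γ hγ
          exact Or.inr ⟨β, hβ, h.trans (List.prefix_append _ _), hγ⟩
    · rintro r hr ⟨hr1, hr2⟩ hlen
      simp only at hr1 hlen
      rcases hr2 hr.2.2.1 with h | ⟨β, hβ, h, hrT⟩
      · have := h.length_le
        omega
      · refine (hQ β hβ).2.2.2 r hr ⟨by rw [(hQ β hβ).2.1]; exact h, ?_⟩
          (by rw [(hQ β hβ).2.1]; simp; omega)
        intro u hu
        rcases hr.2.2.2.2.1 u hu with h' | h'
        · exact (hQ β hβ).1.2.2.2.2.2.1 _ _ hrT h'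
        · rcases hr2 hu with h2 | ⟨γ, hγ, h2, h3⟩
          · have e1 := h2.length_le
            have e2 := h'.length_le
            omega
          · have e : t ++ [β] = t ++ [γ] := by
              have hh := List.prefix_of_prefix_length_le (h.trans h') h2 (by simp)
              exact hh.eq_of_length (by simp)
            have : β = γ := by simpa using e
            subst this
            exact h3

/-- the tree Prikry forcing satisfies the *-Prikry condition: for
every condition `p` and dense open `D` there are `n : ℕ` and a direct extension
`q ≤* p` such that every `r ≤ q` with `l r = l q + n` belongs to `D`. -/
theorem treePrikry_star_condition (κ : Cardinal.{0}) (U : Set (Set Ordinal.{0}))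
    (hκ : Cardinal.aleph0 < κ)
    (hU : IsUltrafilterOn κ U) (hcomp : IsKappaComplete κ U)
    (hnp : IsNonprincipal U)
    (p : TCond) (hp : TIsCond κ U p)
    (D : Set TCond) (hD : TDenseOpen κ U D) :
    ∃ n : ℕ, ∃ q : TCond, TIsCond κ U q ∧ TDirExt q p ∧
      ∀ r : TCond, TIsCond κ U r → TExt r q →
        r.s.length = q.s.length + n → r ∈ D := by
  obtain ⟨n, hn⟩ := tgood_exists κ U hκ hU hcomp p hp D hD
  obtain ⟨q, hq, hqs, hqT, h⟩ := tgood_spec κ U hU p hp D hD n p.s hp.2.2.1 hn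
  exact ⟨n, q, hq, ⟨⟨by rw [hqs], hqT⟩, hqs⟩, h⟩
end

section
/- Let κ be a measurable cardinal, U a κ-complete nonprincipal ultrafilter on κ, and ℙ the tree Prikry forcing on κ. For every dense open subset D of ℙ and every condition p ∈ ℙ there exists a direct extension q ≤* p such that for every t ∈ T^q end-extending the stem s_p: if some direct extension of q ⊕ t belongs to D, then already q ⊕ t ∈ D (that is, membership of extensions of q in D does not depend on the tree part). -/
/-- `p ⊕ t = (t, (T^p)_t)`, the extension of `p` with stem `t`. -/
def TOplus (p : TCond) (t : List Ordinal.{0}) : TCond :=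
  ⟨t, {u ∈ p.T | u <+: t ∨ t <+: u}⟩

theorem TOplus_cond (κ : Cardinal.{0}) (U : Set (Set Ordinal.{0}))
    (q : TCond) (hq : TIsCond κ U q) (hU : IsUltrafilterOn κ U)
    (t : List Ordinal.{0}) (ht : t ∈ q.T) (hst : q.s <+: t) :
    TIsCond κ U (TOplus q t) := by
  obtain ⟨h1, h2, h3, h4, h5, h6, h7⟩ := hq
  refine ⟨(h4 t ht).1, (h4 t ht).2, ⟨ht, Or.inl (List.prefix_refl _)⟩, fun u hu => h4 u hu.1,
    fun u hu => hu.2, ?_, ?_⟩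
  · rintro v u ⟨hu, hut⟩ hvu
    refine ⟨h6 v u hu hvu, ?_⟩
    rcases hut with h | h
    · exact Or.inl (hvu.trans h)
    · exact List.prefix_or_prefix_of_prefix hvu h
  · rintro u ⟨hu, _⟩ htu
    have htu' : t <+: u := htu
    have := h7 u hu (hst.trans htu')
    refine hU.2.2.2.1 _ _ this ?_ ?_
    · intro β hβ
      exact ⟨hβ, Or.inr (htu'.trans (List.prefix_append _ _))⟩
    · intro β hβ
      exact hU.1 _ this hβ.1

/-- for every dense open `D` and every condition `p` there is a
direct extension `q ≤* p` such that for every `t ∈ T^q` end-extending the stem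
of `p`: if some direct extension of `q ⊕ t` is in `D`, then `q ⊕ t ∈ D`. -/
theorem treePrikry_reduction_step_one (κ : Cardinal.{0}) (U : Set (Set Ordinal.{0}))
    (hκ : Cardinal.aleph0 < κ)
    (hU : IsUltrafilterOn κ U) (hcomp : IsKappaComplete κ U)
    (hnp : IsNonprincipal U)
    (D : Set TCond) (hD : TDenseOpen κ U D)
    (p : TCond) (hp : TIsCond κ U p) :
    ∃ q : TCond, TIsCond κ U q ∧ TDirExt q p ∧
      ∀ t ∈ q.T, p.s <+: t →
        (∃ r : TCond, TIsCond κ U r ∧ TDirExt r (TOplus q t) ∧ r ∈ D) →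
        TOplus q t ∈ D := by
  classical
  obtain ⟨hDc, -, hDo⟩ := hD
  have hRex : ∀ t : List Ordinal.{0}, ∃ r : TCond,
      (∃ r : TCond, r ∈ D ∧ r.s = t) → (r ∈ D ∧ r.s = t) := by
    intro t
    by_cases h : ∃ r : TCond, r ∈ D ∧ r.s = t
    · obtain ⟨r, hr⟩ := h
      exact ⟨r, fun _ => hr⟩
    · exact ⟨p, fun h' => absurd h' h⟩
  choose R hR using hRex
  let G : List Ordinal.{0} → Prop := fun t => ∃ r : TCond, r ∈ D ∧ r.s = t
  have hRself : ∀ t, G t → t ∈ (R t).T := by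
    intro t ht
    have h := hR t ht
    have := (hDc _ h.1).2.2.1
    rwa [h.2] at this
  have hRcl : ∀ t, G t → ∀ v u : List Ordinal.{0}, u ∈ (R t).T → v <+: u → v ∈ (R t).T := by
    intro t ht
    exact (hDc _ (hR t ht).1).2.2.2.2.2.1
  obtain ⟨h1, h2, h3, h4, h5, h6, h7⟩ := id hp
  let q : TCond := ⟨p.s, {u | u ∈ p.T ∧ ∀ t, p.s <+: t → t <+: u → G t → u ∈ (R t).T}⟩
  have hq : TIsCond κ U q := by
    refine ⟨h1, h2, ⟨h3, ?_⟩, fun t ht => h4 t ht.1, fun t ht => h5 t ht.1, ?_, ?_⟩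
    · intro t hst hts hG
      exact hRcl t hG _ _ (hRself t hG) hst
    · rintro v u ⟨hu, hu2⟩ hvu
      refine ⟨h6 v u hu hvu, ?_⟩
      intro t hst htv hG
      exact hRcl t hG _ _ (hu2 t hst (htv.trans hvu) hG) hvu
    · rintro u ⟨hu, hu2⟩ hsu
      have hsu' : p.s <+: u := hsu
      have hbase := h7 u hu hsu'
      have key : ∀ l : List (List Ordinal.{0}),
          {β : Ordinal.{0} | u ++ [β] ∈ p.T ∧
            ∀ t ∈ l, p.s <+: t → t <+: u → G t → u ++ [β] ∈ (R t).T} ∈ U := by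
        intro l
        induction l with
        | nil =>
          refine hU.2.2.2.1 _ _ hbase ?_ ?_
          · intro β hβ
            exact ⟨hβ, by simp⟩
          · intro β hβ
            exact hU.1 _ hbase hβ.1
        | cons a l ih =>
          by_cases ha : p.s <+: a ∧ a <+: u ∧ G a
          · obtain ⟨ha1, ha2, ha3⟩ := ha
            have hRa := hR a ha3
            have hs := (hDc _ hRa.1).2.2.2.2.2.2 u (hu2 a ha1 ha2 ha3) (by rw [hRa.2]; exact ha2)
            refine hU.2.2.2.1 _ _ (hU.2.2.2.2.1 _ _ ih hs) ?_ ?_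
            · rintro β ⟨⟨hb1, hb2⟩, hb3⟩
              refine ⟨hb1, ?_⟩
              intro t ht
              rcases List.mem_cons.1 ht with rfl | ht
              · intro _ _ _
                exact hb3
              · exact hb2 t ht
            · intro β hβ
              exact hU.1 _ hbase hβ.1
          · refine hU.2.2.2.1 _ _ ih ?_ ?_
            · rintro β ⟨hb1, hb2⟩
              refine ⟨hb1, ?_⟩
              intro t ht
              rcases List.mem_cons.1 ht with rfl | ht
              · intro x y z
                exact absurd ⟨x, y, z⟩ ha
              · exact hb2 t ht
            · intro β hβ
              exact hU.1 _ hbase hβ.1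
      refine hU.2.2.2.1 _ _ (key u.inits) ?_ ?_
      · rintro β ⟨hb1, hb2⟩
        refine ⟨hb1, ?_⟩
        intro t hst htu hG
        rcases List.prefix_concat_iff.1 htu with h | h
        · have := hRself t hG
          rw [h] at this ⊢
          exact this
        · exact hb2 t ((List.mem_inits _ _).2 h) hst h hG
      · intro β hβ
        exact hU.1 _ hbase hβ.1
  refine ⟨q, hq, ⟨⟨List.prefix_refl _, fun u hu => hu.1⟩, rfl⟩, ?_⟩
  rintro t ht hst ⟨r, hr, ⟨_, hrs⟩, hrD⟩
  have hG : G t := ⟨r, hrD, hrs⟩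
  have hRt := hR t hG
  refine hDo _ hRt.1 _ (TOplus_cond κ U q hq hU t ht hst) ⟨?_, ?_⟩
  · rw [hRt.2]
    exact List.prefix_refl _
  · rintro u ⟨hu, h | h⟩
    · exact hRcl t hG _ _ (hRself t hG) h
    · exact hu.2 t hst h hG
end

section
/- Let κ be a measurable cardinal, U a κ-complete nonprincipal ultrafilter on κ, and ℙ the tree Prikry forcing on κ. For every dense open subset D of ℙ and every condition p ∈ ℙ there exists a direct extension q ≤* p such that membership in D of extensions of q depends only on length: for all t, t' ∈ T^q end-extending the stem s_p with lh(t) = lh(t'), one has q ⊕ t ∈ D if and only if q ⊕ t' ∈ D. -/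
theorem aux_oplus {κ : Cardinal.{0}} {U : Set (Set Ordinal.{0})} (hU : IsUltrafilterOn κ U)
    {p : TCond} (hp : TIsCond κ U p) {t : List Ordinal.{0}} (ht : t ∈ p.T) (hst : p.s <+: t) :
    TIsCond κ U (TOplus p t) := by
  obtain ⟨h1, h2, h3, h4, h5, h6, h7⟩ := hp
  refine ⟨(h4 t ht).1, (h4 t ht).2, ⟨ht, Or.inl List.prefix_rfl⟩, fun u hu => h4 u hu.1,
    fun u hu => hu.2, ?_, ?_⟩
  · rintro a b ⟨hb, hb'⟩ hab
    refine ⟨h6 a b hb hab, ?_⟩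
    rcases hb' with hb' | hb'
    · exact Or.inl (hab.trans hb')
    · exact List.prefix_or_prefix_of_prefix hab hb'
  · rintro u ⟨hu, -⟩ htu
    have htu' : t <+: u := htu
    have := h7 u hu (hst.trans htu')
    have e : {β : Ordinal.{0} | u ++ [β] ∈ (TOplus p t).T} = {β | u ++ [β] ∈ p.T} := by
      ext β
      exact ⟨fun h => h.1, fun h => ⟨h, Or.inr (htu'.trans (List.prefix_append _ _))⟩⟩
    rw [e]; exact this

theorem aux_countable {κ : Cardinal.{0}} {U : Set (Set Ordinal.{0})}
    (hκ : Cardinal.aleph0 < κ) (hcomp : IsKappaComplete κ U)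
    (g : ℕ → Set Ordinal.{0}) (hg : ∀ n, g n ∈ U) :
    {β | β < κ.ord ∧ ∀ n, β ∈ g n} ∈ U := by
  have hω : Ordinal.omega0 < κ.ord := by
    rw [← Cardinal.ord_aleph0]; exact Cardinal.ord_lt_ord.2 hκ
  have := hcomp Ordinal.omega0 hω (fun i => g (Cardinal.toNat i.card)) (fun i _ => hg _)
  convert this using 1
  ext β
  simp only [Set.mem_setOf_eq, Set.mem_inter_iff, Set.mem_Iio, Set.mem_iInter]
  refine and_congr_right fun _ => ⟨fun h i _ => h _, fun h n => ?_⟩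
  have := h n (Ordinal.natCast_lt_omega0 n)
  simpa using this

def auxC (κ : Cardinal.{0}) (U : Set (Set Ordinal.{0})) (A : Set (List Ordinal.{0})) :
    ℕ → List Ordinal.{0} → Prop
  | 0, t => t ∈ A
  | n + 1, t => {β | β < κ.ord ∧ auxC κ U A n (t ++ [β])} ∈ U

theorem aux_color {κ : Cardinal.{0}} {U : Set (Set Ordinal.{0})} (hU : IsUltrafilterOn κ U)
    (A : Set (List Ordinal.{0})) (n : ℕ) (t : List Ordinal.{0}) :
    {β | β < κ.ord ∧ (auxC κ U A n (t ++ [β]) ↔ auxC κ U A (n + 1) t)} ∈ U := by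
  obtain ⟨u1, u2, u3, u4, u5, u6⟩ := hU
  by_cases h : auxC κ U A (n + 1) t
  · have h' : {β | β < κ.ord ∧ auxC κ U A n (t ++ [β])} ∈ U := h
    simpa only [h, iff_true] using h'
  · have h' : {β | β < κ.ord ∧ auxC κ U A n (t ++ [β])} ∉ U := h
    rcases u6 _ (fun β (hβ : β ∈ {β | β < κ.ord ∧ auxC κ U A n (t ++ [β])}) => hβ.1) with h2 | h2
    · exact absurd h2 h'
    · refine u4 _ _ h2 ?_ (fun β hβ => hβ.1)
      rintro β ⟨hβ, hβ'⟩
      exact ⟨hβ, iff_of_false (fun hc => hβ' ⟨hβ, hc⟩) h⟩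

theorem aux_R {κ : Cardinal.{0}} {U : Set (Set Ordinal.{0})} (hU : IsUltrafilterOn κ U)
    {D : Set TCond} (hD : TDenseOpen κ U D) {p : TCond} (hp : TIsCond κ U p)
    (t : List Ordinal.{0}) : ∃ r : TCond, t ∈ p.T → p.s <+: t →
      TIsCond κ U r ∧ r.s = t ∧ r.T ⊆ p.T ∧
      (∀ r' ∈ D, r'.s = t → r'.T ⊆ p.T → r ∈ D) := by
  by_cases h : ∃ r' ∈ D, r'.s = t ∧ r'.T ⊆ p.T
  · obtain ⟨r, hr, h1, h2⟩ := h
    exact ⟨r, fun _ _ => ⟨hD.1 r hr, h1, h2, fun _ _ _ _ => hr⟩⟩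
  · exact ⟨TOplus p t, fun h1 h2 => ⟨aux_oplus hU hp h1 h2, rfl, fun u hu => hu.1,
      fun r' a b c => absurd ⟨r', a, b, c⟩ h⟩⟩

/-- for every dense open `D` and condition `p` there is a direct
extension `q ≤* p` such that membership in `D` of extensions of `q` depends only
on length: for `t, t' ∈ T^q` end-extending the stem of `p` and of equal length,
`q ⊕ t ∈ D ↔ q ⊕ t' ∈ D`. -/
theorem treePrikry_reduction_step_two (κ : Cardinal.{0}) (U : Set (Set Ordinal.{0}))
    (hκ : Cardinal.aleph0 < κ)
    (hU : IsUltrafilterOn κ U) (hcomp : IsKappaComplete κ U)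
    (hnp : IsNonprincipal U)
    (D : Set TCond) (hD : TDenseOpen κ U D)
    (p : TCond) (hp : TIsCond κ U p) :
    ∃ q : TCond, TIsCond κ U q ∧ TDirExt q p ∧
      ∀ t ∈ q.T, ∀ t' ∈ q.T, p.s <+: t → p.s <+: t' →
        t.length = t'.length → (TOplus q t ∈ D ↔ TOplus q t' ∈ D) := by
  choose R hR using aux_R hU hD hp
  obtain ⟨p1, p2, p3, p4, p5, p6, p7⟩ := id hp
  obtain ⟨u1, u2, u3, u4, u5, u6⟩ := id hU
  let C := auxC κ U {t | R t ∈ D}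
  let q : TCond := ⟨p.s, {u | u ∈ p.T ∧ ∀ t, p.s <+: t → t <+: u → u ∈ (R t).T ∧
    ∀ β, t ++ [β] <+: u → ∀ n, (C n (t ++ [β]) ↔ C (n + 1) t)}⟩
  have hself : ∀ t ∈ p.T, p.s <+: t → t ∈ (R t).T := by
    intro t ht hst
    obtain ⟨r1, r2, r3, r4⟩ := hR t ht hst
    have := r1.2.2.1
    rwa [r2] at this
  have hq : TIsCond κ U q := by
    refine ⟨p1, p2, ⟨p3, ?_⟩, fun t ht => p4 t ht.1, fun t ht => p5 t ht.1, ?_, ?_⟩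
    · intro t h1 h2
      have : p.s = t := h1.eq_of_length (le_antisymm h1.length_le h2.length_le)
      subst this
      refine ⟨hself _ p3 List.prefix_rfl, fun β hβ => ?_⟩
      exact absurd hβ.length_le (by simp [q])
    · rintro a b ⟨hb, hb'⟩ hab
      refine ⟨p6 a b hb hab, fun t h1 h2 => ?_⟩
      obtain ⟨h3, h4⟩ := hb' t h1 (h2.trans hab)
      obtain ⟨r1, r2, r3, r4⟩ := hR t (p6 t b hb (h2.trans hab)) h1
      exact ⟨r1.2.2.2.2.2.1 a b h3 hab, fun β hβ => h4 β (hβ.trans hab)⟩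
    · rintro t ⟨ht, ht'⟩ hst
      have hst : p.s <+: t := hst
      have H1 := aux_countable hκ hcomp _ (fun n => aux_color hU {t | R t ∈ D} n t)
      have H2 := aux_countable hκ hcomp
        (fun n => {β | β < κ.ord ∧ (p.s <+: t.take n → t ++ [β] ∈ (R (t.take n)).T)}) (by
          intro n
          by_cases hn : p.s <+: t.take n
          · have htn : t.take n <+: t := List.take_prefix n t
            obtain ⟨r1, r2, r3, r4⟩ := hR _ (p6 _ t ht htn) hn
            have hS := r1.2.2.2.2.2.2 t (ht' _ hn htn).1 (by rw [r2]; exact htn)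
            exact u4 _ _ hS (fun β hβ => ⟨u1 _ hS hβ, fun _ => hβ⟩) (fun β hβ => hβ.1)
          · exact u4 _ _ u2 (fun β hβ => ⟨hβ, fun h => absurd h hn⟩) (fun β hβ => hβ.1))
      have H3 := p7 t ht hst
      have H := u5 _ _ (u5 _ _ H1 H2) H3
      refine u4 _ _ H ?_ ?_
      · rintro β ⟨⟨⟨_, hc⟩, ⟨_, hr⟩⟩, hβ⟩
        have hβ : t ++ [β] ∈ p.T := hβ
        refine ⟨hβ, fun t' h1 h2 => ?_⟩
        rcases List.prefix_concat_iff.1 h2 with h2 | h2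
        · subst h2
          refine ⟨hself _ hβ h1, fun γ hγ => ?_⟩
          have := hγ.length_le
          simp at this
        · constructor
          · have e := List.prefix_iff_eq_take.1 h2
            have := (hr t'.length).2
            rw [← e] at this
            exact this h1
          · intro γ hγ n
            rcases List.prefix_concat_iff.1 hγ with h3 | h3
            · have h4 := List.append_inj' h3 rfl
              have h5 : γ = β := by simpa using h4.2
              rw [h4.1, h5]
              exact (hc n).2
            · exact (ht' t' h1 h2).2 γ h3 n
      · intro β hβ
        exact (p4 _ hβ.1).1 β (by simp)
  refine ⟨q, hq, ⟨⟨List.prefix_rfl, fun u hu => hu.1⟩, rfl⟩, ?_⟩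
  have key : ∀ t ∈ q.T, p.s <+: t → (TOplus q t ∈ D ↔ R t ∈ D) := by
    intro t ht hst
    obtain ⟨r1, r2, r3, r4⟩ := hR t ht.1 hst
    constructor
    · intro h
      exact r4 _ h rfl (fun u hu => hu.1.1)
    · intro h
      refine hD.2.2 _ h _ (aux_oplus hU hq ht hst) ⟨by rw [r2]; exact List.prefix_rfl, ?_⟩
      rintro u ⟨hu, h1 | h1⟩
      · exact r1.2.2.2.2.2.1 u t (hself t ht.1 hst) h1
      · exact (hu.2 t hst h1).1
  have hom : ∀ l : List Ordinal.{0}, p.s ++ l ∈ q.T → ∀ n,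
      (C n (p.s ++ l) ↔ C (n + l.length) p.s) := by
    intro l
    induction l using List.reverseRecOn with
    | nil => intro _ n; simp
    | append_singleton l a ih =>
      intro h n
      rw [← List.append_assoc] at h ⊢
      have h' : p.s ++ l ∈ q.T := hq.2.2.2.2.2.1 _ _ h (List.prefix_append _ _)
      have h2 := (h.2 (p.s ++ l) (List.prefix_append _ _) (List.prefix_append _ _)).2 a
        List.prefix_rfl n
      rw [h2, ih h' (n + 1)]
      have e : n + (l ++ [a]).length = n + 1 + l.length := by simp; omega
      rw [e]
  intro t ht t' ht' hst hst' hlen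
  rw [key t ht hst, key t' ht' hst']
  obtain ⟨l, rfl⟩ := hst
  obtain ⟨l', rfl⟩ := hst'
  have e : l.length = l'.length := by simpa using hlen
  have a1 := hom l ht 0
  have a2 := hom l' ht' 0
  rw [e] at a1
  exact a1.trans a2.symm
end

section
/- Let λ be a cardinal of cofinality ω and let ℙ be a poset with a length function l : ℙ → ω satisfying l(p) ≥ l(q) whenever p ≤ q. Suppose ℙ is λ-geometric and that for every natural number n the set E_n = {r ∈ ℙ : l(r) > n} is dense in ℙ. Then for every p ∈ ℙ and every family ⟨D_α : α < λ⟩ of dense open subsets of ℙ there exists a filter H on ℙ such that p ∈ H and H meets every D_α (α < λ). -/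
/-- A filter on a poset `P`: a nonempty, upward closed subset any two of whose
elements have a common lower bound in it. -/
def IsPosetFilter {P : Type*} [PartialOrder P] (F : Set P) : Prop :=
  F.Nonempty ∧ (∀ p ∈ F, ∀ q : P, p ≤ q → q ∈ F) ∧
  (∀ p ∈ F, ∀ q ∈ F, ∃ r ∈ F, r ≤ p ∧ r ≤ q)

/-- A subset `D` of a poset is dense open: every element has an extension
(a smaller element) in `D`, and every extension of an element of `D` is in `D`. -/
def IsPosetDenseOpen {P : Type*} [PartialOrder P] (D : Set P) : Prop :=
  (∀ p : P, ∃ q ≤ p, q ∈ D) ∧ (∀ p ∈ D, ∀ q : P, q ≤ p → q ∈ D)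

/-- A poset `P` with a length function `l : P → ℕ` (antitone with respect to the
order) is `λ`-geometric: for every `γ < λ` and every family of dense open sets
`⟨D β : β < γ⟩`, every `p` has an extension `q ≤ p` such that every filter
containing `q` and meeting every `E n = {r : l r > n}` also meets every `D β`. -/
def IsGeometric {P : Type*} [PartialOrder P] (lam : Cardinal.{0}) (l : P → ℕ) : Prop :=
  ∀ γ < lam.ord, ∀ D : Ordinal.{0} → Set P,
    (∀ β < γ, IsPosetDenseOpen (D β)) →
    ∀ p : P, ∃ q ≤ p,
      ∀ F : Set P, IsPosetFilter F → q ∈ F →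
        (∀ n : ℕ, ∃ r ∈ F, n < l r) →
        ∀ β < γ, (F ∩ D β).Nonempty

/-- if `λ` is a cardinal of cofinality `ω` and `P` is a
`λ`-geometric poset (with an antitone length function `l`) in which every
`E n = {r : l r > n}` is dense, then for every `p` and every family
`⟨D α : α < λ⟩` of dense open sets there is a filter `H` containing `p` and
meeting every `D α`. -/
theorem geometric_gives_generic_filter {P : Type*} [PartialOrder P]
    (lam : Cardinal.{0}) (hcof : lam.ord.cof = Cardinal.aleph0)
    (l : P → ℕ) (hl : ∀ p q : P, p ≤ q → l q ≤ l p)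
    (hgeo : IsGeometric lam l)
    (hE : ∀ n : ℕ, ∀ p : P, ∃ q ≤ p, n < l q)
    (p : P) (D : Ordinal.{0} → Set P)
    (hD : ∀ α < lam.ord, IsPosetDenseOpen (D α)) :
    ∃ H : Set P, IsPosetFilter H ∧ p ∈ H ∧
      ∀ α < lam.ord, (H ∩ D α).Nonempty := by
  have hlim : Order.IsSuccLimit lam.ord := by
    rw [← Ordinal.one_lt_cof_iff, hcof]
    exact Cardinal.one_lt_aleph0
  have hc : Order.cof (Set.Iio lam.ord) = Cardinal.aleph0 := by
    rw [Ordinal.cof_Iio, ← Ordinal.lift_cof, hcof, Cardinal.lift_aleph0]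
  obtain ⟨S, hS, hS'⟩ := Order.exists_cof_eq (Set.Iio lam.ord)
  rw [hc] at hS'
  have hcount : S.Countable := by
    rw [← Cardinal.le_aleph0_iff_set_countable, hS']
  have hne : S.Nonempty := by
    rw [Set.nonempty_iff_ne_empty]
    rintro rfl
    simp at hS'
    exact Cardinal.aleph0_ne_zero hS'.symm
  obtain ⟨f, hf⟩ := hcount.exists_eq_range hne
  have step : ∀ (n : ℕ) (x : P), ∃ y ≤ x, n < l y ∧
      ∀ F : Set P, IsPosetFilter F → y ∈ F → (∀ n : ℕ, ∃ r ∈ F, n < l r) →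
        ∀ β < (f n : Ordinal), (F ∩ D β).Nonempty := by
    intro n x
    obtain ⟨q, hq, h⟩ := hgeo (f n) (f n).2 D
      (fun β hβ => hD β (hβ.trans (f n).2)) x
    obtain ⟨y, hy, hy'⟩ := hE n q
    exact ⟨y, hy.trans hq, hy', fun F hF hyF => h F hF (hF.2.1 y hyF q hy)⟩
  choose g hg1 hg2 hg3 using step
  let s : ℕ → P := fun n => Nat.rec p g n
  have hs : ∀ n, s (n + 1) = g n (s n) := fun n => rfl
  have hanti : Antitone s := antitone_nat_of_succ_le fun n => by
    rw [hs]; exact hg1 n (s n)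
  have hH : IsPosetFilter {x | ∃ n, s n ≤ x} := by
    refine ⟨⟨p, 0, le_rfl⟩, ?_, ?_⟩
    · rintro a ⟨n, hn⟩ b hab
      exact ⟨n, hn.trans hab⟩
    · rintro a ⟨n, hn⟩ b ⟨m, hm⟩
      exact ⟨s (max n m), ⟨_, le_rfl⟩, (hanti (le_max_left n m)).trans hn,
        (hanti (le_max_right n m)).trans hm⟩
  refine ⟨_, hH, ⟨0, le_rfl⟩, ?_⟩
  intro α hα
  obtain ⟨b, hb, hab⟩ := hS ⟨Order.succ α, hlim.succ_lt hα⟩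
  rw [hf] at hb
  obtain ⟨n, rfl⟩ := hb
  have hab' : Order.succ α ≤ (f n : Ordinal) := hab
  exact hg3 n (s n) _ hH ⟨n + 1, le_rfl⟩
    (fun k => ⟨s (k + 1), ⟨k + 1, le_rfl⟩, hg2 k (s k)⟩) α (Order.succ_le_iff.1 hab')
end

section
/- Let κ be an inaccessible cardinal and for each n < ω let U_n be a κ-complete fine normal ultrafilter on 𝒫_κ(κ^{+n}), and let ℚ be the diagonal supercompact Prikry forcing. Then ℚ satisfies the *-Prikry condition: for every condition p ∈ ℚ and every dense open subset D of ℚ there exist a direct extension q ≤* p and a natural number m such that q ⊕ a⃗ ∈ D for every ⊂̃-increasing sequence a⃗ = ⟨a(l(q)), …, a(l(q)+m−1)⟩ with a(i) ∈ X_i^q for each i. -/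
/-- The order type of a set of ordinals. -/
noncomputable def otype (a : Set Ordinal.{0}) : Ordinal.{1} :=
  Ordinal.type (α := ↥a) (· < ·)

/-- `𝒫_κ(μ)`: the subsets of `μ` (i.e. of `Set.Iio μ.ord`) of cardinality `< κ`. -/
def Pkm (κ μ : Cardinal.{0}) : Set (Set Ordinal.{0}) :=
  {a | a ⊆ Set.Iio μ.ord ∧ Cardinal.mk ↥a < Cardinal.lift.{1} κ}

/-- `a ⊂̃ b`: `a ⊆ b`, `b ∩ κ` is an ordinal `c` below `κ`, and `ot a < c`. -/
def SubTilde (κ : Cardinal.{0}) (a b : Set Ordinal.{0}) : Prop :=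
  a ⊆ b ∧ ∃ c : Ordinal.{0}, c < κ.ord ∧
    b ∩ Set.Iio κ.ord = Set.Iio c ∧ otype a < Ordinal.lift.{1} c

/-- `W` is an ultrafilter on `𝒫_κ(μ)`. -/
def DIsUltra (κ μ : Cardinal.{0}) (W : Set (Set (Set Ordinal.{0}))) : Prop :=
  (∀ X ∈ W, X ⊆ Pkm κ μ) ∧
  Pkm κ μ ∈ W ∧
  (∅ : Set (Set Ordinal.{0})) ∉ W ∧
  (∀ X Y : Set (Set Ordinal.{0}), X ∈ W → X ⊆ Y → Y ⊆ Pkm κ μ → Y ∈ W) ∧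
  (∀ X Y : Set (Set Ordinal.{0}), X ∈ W → Y ∈ W → X ∩ Y ∈ W) ∧
  (∀ X : Set (Set Ordinal.{0}), X ⊆ Pkm κ μ → X ∈ W ∨ Pkm κ μ \ X ∈ W)

/-- `W` is κ-complete: intersections of families of fewer than κ members of `W`
(indexed by an ordinal `γ < κ`) are in `W`. -/
def DComplete (κ μ : Cardinal.{0}) (W : Set (Set (Set Ordinal.{0}))) : Prop :=
  ∀ γ < κ.ord, ∀ f : Ordinal.{0} → Set (Set Ordinal.{0}),
    (∀ i < γ, f i ∈ W) → (Pkm κ μ ∩ ⋂ i ∈ Set.Iio γ, f i) ∈ W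

/-- `W` is fine: `{a : ξ ∈ a} ∈ W` for every `ξ < μ`. -/
def DFine (κ μ : Cardinal.{0}) (W : Set (Set (Set Ordinal.{0}))) : Prop :=
  ∀ ξ < μ.ord, {a ∈ Pkm κ μ | ξ ∈ a} ∈ W

/-- `W` is normal in the sense of diagonal intersections: whenever `A a ∈ W` for
every `a ∈ 𝒫_κ(μ)`, the diagonal intersection
`Δ A = {b : b ∩ κ ∈ κ and b ∈ A a for every a ⊂̃ b}` belongs to `W`. -/
def DNormal (κ μ : Cardinal.{0}) (W : Set (Set (Set Ordinal.{0}))) : Prop :=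
  ∀ A : Set Ordinal.{0} → Set (Set Ordinal.{0}),
    (∀ a ∈ Pkm κ μ, A a ∈ W) →
    {b ∈ Pkm κ μ | (∃ c < κ.ord, b ∩ Set.Iio κ.ord = Set.Iio c) ∧
      ∀ a ∈ Pkm κ μ, SubTilde κ a b → b ∈ A a} ∈ W

/-- A condition of the diagonal supercompact Prikry forcing:
`p = ⟨a 0, …, a (n−1), X n, X (n+1), …⟩`, encoded as a triple of the length `n`,
the function `a` (only its values below `n` matter) and the function `X`
(only its values from `n` on matter). -/
structure QCond : Type 1 where
  n : ℕ
  a : ℕ → Set Ordinal.{0}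
  X : ℕ → Set (Set Ordinal.{0})

/-- `p` is a condition of the diagonal supercompact Prikry forcing for the
sequence of measures `U m` on `𝒫_κ(μ m)`. -/
def QIsCond (κ : Cardinal.{0}) (μ : ℕ → Cardinal.{0})
    (U : ℕ → Set (Set (Set Ordinal.{0}))) (p : QCond) : Prop :=
  (∀ l < p.n, p.a l ∈ Pkm κ (μ l) ∧
    ∃ c : Cardinal.{0}, p.a l ∩ Set.Iio κ.ord = Set.Iio c.ord ∧ c.IsInaccessible) ∧
  (∀ m, p.n ≤ m → p.X m ∈ U m) ∧
  (∀ m, p.n ≤ m → ∀ b ∈ p.X m, ∀ l < p.n, SubTilde κ (p.a l) b) ∧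
  (∀ i j, i < j → j < p.n → SubTilde κ (p.a i) (p.a j))

/-- `v` is an admissible vector extending `p` to length `m`: on `[l(p), m)` its
entries are `⊂̃`-increasing and `v i ∈ X_i^p`. -/
def GoodVec (κ : Cardinal.{0}) (p : QCond) (v : ℕ → Set Ordinal.{0}) (m : ℕ) : Prop :=
  (∀ i, p.n ≤ i → i < m → v i ∈ p.X i) ∧
  (∀ i j, p.n ≤ i → i < j → j < m → SubTilde κ (v i) (v j))

/-- `p ⊕ v`: the extension of `p` by the vector `v`, of new length `m`. -/
def QOplus (κ : Cardinal.{0}) (p : QCond) (v : ℕ → Set Ordinal.{0}) (m : ℕ) : QCond where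
  n := m
  a := fun i => if i < p.n then p.a i else v i
  X := fun j => {b ∈ p.X j | ∀ i, p.n ≤ i → i < m → SubTilde κ (v i) b}

/-- `q ≤* p`: `q` is a direct extension of `p`. -/
def QDirExt (q p : QCond) : Prop :=
  q.n = p.n ∧ (∀ l < p.n, q.a l = p.a l) ∧ ∀ m, p.n ≤ m → q.X m ⊆ p.X m

/-- `q ≤ p`: `q` extends `p`, i.e. `q` is a direct extension of `p` or of some
`p ⊕ v`. -/
def QExt (κ : Cardinal.{0}) (q p : QCond) : Prop :=
  QDirExt q p ∨ ∃ v : ℕ → Set Ordinal.{0}, ∃ m : ℕ, p.n ≤ m ∧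
    GoodVec κ p v m ∧ QDirExt q (QOplus κ p v m)

/-- `D` is a dense open subset of the diagonal supercompact Prikry forcing. -/
def QDenseOpen (κ : Cardinal.{0}) (μ : ℕ → Cardinal.{0})
    (U : ℕ → Set (Set (Set Ordinal.{0}))) (D : Set QCond) : Prop :=
  (∀ p ∈ D, QIsCond κ μ U p) ∧
  (∀ p, QIsCond κ μ U p → ∃ q ∈ D, QExt κ q p) ∧
  (∀ p ∈ D, ∀ q, QIsCond κ μ U q → QExt κ q p → q ∈ D)

/-- A filter on the diagonal supercompact Prikry poset. -/
def QIsFilter (κ : Cardinal.{0}) (μ : ℕ → Cardinal.{0})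
    (U : ℕ → Set (Set (Set Ordinal.{0}))) (F : Set QCond) : Prop :=
  F.Nonempty ∧ (∀ p ∈ F, QIsCond κ μ U p) ∧
  (∀ p ∈ F, ∀ q, QIsCond κ μ U q → QExt κ p q → q ∈ F) ∧
  (∀ p ∈ F, ∀ q ∈ F, ∃ r ∈ F, QExt κ r p ∧ QExt κ r q)

namespace DPrikry

open Cardinal Filter

variable {κ μ : Cardinal.{0}} {W : Set (Set (Set Ordinal.{0}))}

/-- The four hypotheses on the measure, with `κ` inaccessible and `κ ≤ μ`. -/
structure Meas (κ μ : Cardinal.{0}) (W : Set (Set (Set Ordinal.{0}))) : Prop where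
  inacc : κ.IsInaccessible
  le : κ ≤ μ
  ultra : DIsUltra κ μ W
  compl : DComplete κ μ W
  fine : DFine κ μ W
  normal : DNormal κ μ W

/-- The associated filter on all sets of ordinals. -/
def Meas.F (h : Meas κ μ W) : Filter (Set Ordinal.{0}) where
  sets := {Y | Y ∩ Pkm κ μ ∈ W}
  univ_sets := by simpa using h.ultra.2.1
  sets_of_superset := by
    intro x y hx hxy
    exact h.ultra.2.2.2.1 _ _ hx (Set.inter_subset_inter_left _ hxy) Set.inter_subset_right
  inter_sets := by
    intro x y hx hy
    have := h.ultra.2.2.2.2.1 _ _ hx hy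
    show (x ∩ y) ∩ Pkm κ μ ∈ W
    rw [Set.inter_inter_distrib_right]
    exact this

theorem Meas.mem_iff (h : Meas κ μ W) {Y} (hY : Y ⊆ Pkm κ μ) : Y ∈ W ↔ Y ∈ h.F := by
  show _ ↔ Y ∩ Pkm κ μ ∈ W
  rw [Set.inter_eq_left.2 hY]

theorem Meas.ev_iff (h : Meas κ μ W) {P : Set Ordinal.{0} → Prop} :
    (∀ᶠ b in h.F, P b) ↔ {b ∈ Pkm κ μ | P b} ∈ W := by
  show _ ∩ Pkm κ μ ∈ W ↔ _
  rw [Set.inter_comm]; rfl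

theorem Meas.ev_of_mem (h : Meas κ μ W) {Y} (hY : Y ∈ W) : ∀ᶠ b in h.F, b ∈ Y :=
  (h.mem_iff (h.ultra.1 _ hY)).1 hY

theorem Meas.ev_Pkm (h : Meas κ μ W) : ∀ᶠ b in h.F, b ∈ Pkm κ μ :=
  h.ev_of_mem h.ultra.2.1

theorem Meas.neBot (h : Meas κ μ W) : h.F.NeBot := by
  refine ⟨fun hb => h.ultra.2.2.1 ?_⟩
  rw [h.mem_iff (Set.empty_subset _), hb]; trivial

theorem Meas.ev_or (h : Meas κ μ W) (P : Set Ordinal.{0} → Prop) :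
    (∀ᶠ b in h.F, P b) ∨ (∀ᶠ b in h.F, ¬ P b) := by
  rw [h.ev_iff, h.ev_iff]
  rcases h.ultra.2.2.2.2.2 {b ∈ Pkm κ μ | P b} (fun _ hb => hb.1) with h1 | h1
  · exact Or.inl h1
  · right
    convert h1 using 1
    ext b; simp only [Set.mem_ofPred_eq, Set.mem_sdiff]; tauto

theorem Meas.ev_forall (h : Meas κ μ W) {ι : Type 1} (hι : #ι < Cardinal.lift.{1} κ)
    {P : ι → Set Ordinal.{0} → Prop} (hP : ∀ i, ∀ᶠ b in h.F, P i b) :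
    ∀ᶠ b in h.F, ∀ i, P i b := by
  classical
  obtain ⟨c, hc, hcι⟩ := Cardinal.lt_lift_iff.1 hι
  have : #ι = #(Set.Iio c.ord) := by rw [Cardinal.mk_Iio_ordinal, card_ord]; exact hcι.symm
  obtain ⟨e⟩ := Cardinal.eq.1 this
  have := h.compl c.ord (ord_lt_ord.2 hc)
    (fun i => if hi : i < c.ord then {b ∈ Pkm κ μ | P (e.symm ⟨i, hi⟩) b} else ∅) (by
      intro i hi
      simp only [hi, dif_pos]
      exact h.ev_iff.1 (hP _))
  filter_upwards [h.ev_of_mem this] with b hb i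
  have h2 := hb.2
  rw [Set.mem_iInter₂] at h2
  have h3 := h2 (e i).1 (e i).2
  rw [dif_pos (show (e i).1 < c.ord from (e i).2)] at h3
  simpa using h3.2

theorem Meas.aleph0_lt (h : Meas κ μ W) : ℵ₀ < Cardinal.lift.{1} κ := by
  rw [← Cardinal.lift_aleph0.{1, 0}]
  exact Cardinal.lift_lt.2 h.inacc.aleph0_lt

theorem Meas.ev_nat (h : Meas κ μ W)
    {P : ℕ → Set Ordinal.{0} → Prop} (hP : ∀ i, ∀ᶠ b in h.F, P i b) :
    ∀ᶠ b in h.F, ∀ i, P i b := by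
  have := h.ev_forall (ι := ULift.{1} ℕ) (by simpa using h.aleph0_lt)
    (P := fun i => P i.down) (fun i => hP _)
  exact this.mono fun b hb i => hb ⟨i⟩

theorem Meas.ev_fine (h : Meas κ μ W) {ξ : Ordinal.{0}} (hξ : ξ < μ.ord) :
    ∀ᶠ b in h.F, ξ ∈ b := (h.ev_of_mem (h.fine ξ hξ)).mono fun _ hb => hb.2

theorem Meas.ev_fine' (h : Meas κ μ W) {ξ : Ordinal.{0}} (hξ : ξ < κ.ord) :
    ∀ᶠ b in h.F, ξ ∈ b := h.ev_fine (hξ.trans_le (ord_le_ord.2 h.le))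

theorem Meas.ev_normal (h : Meas κ μ W) {P : Set Ordinal.{0} → Set Ordinal.{0} → Prop}
    (hP : ∀ a ∈ Pkm κ μ, ∀ᶠ b in h.F, P a b) :
    ∀ᶠ b in h.F, (∃ c < κ.ord, b ∩ Set.Iio κ.ord = Set.Iio c) ∧
      ∀ a ∈ Pkm κ μ, SubTilde κ a b → P a b := by
  have := h.normal (fun a => {b ∈ Pkm κ μ | P a b}) (fun a ha => h.ev_iff.1 (hP a ha))
  filter_upwards [h.ev_of_mem this] with b hb
  exact ⟨hb.2.1, fun a ha hab => (hb.2.2 a ha hab).2⟩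

/-- `b ∩ κ` as an ordinal. -/
noncomputable def C (κ : Cardinal.{0}) (b : Set Ordinal.{0}) : Ordinal.{0} :=
  Classical.epsilon fun c => c < κ.ord ∧ b ∩ Set.Iio κ.ord = Set.Iio c

theorem Meas.ev_C (h : Meas κ μ W) :
    ∀ᶠ b in h.F, C κ b < κ.ord ∧ b ∩ Set.Iio κ.ord = Set.Iio (C κ b) := by
  filter_upwards [h.ev_normal (P := fun _ _ => True) (by simp)] with b hb
  exact Classical.epsilon_spec hb.1

theorem Meas.ev_lt_C (h : Meas κ μ W) {ξ : Ordinal.{0}} (hξ : ξ < κ.ord) :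
    ∀ᶠ b in h.F, ξ < C κ b := by
  filter_upwards [h.ev_C, h.ev_fine' hξ] with b hb hb2
  have : ξ ∈ b ∩ Set.Iio κ.ord := ⟨hb2, hξ⟩
  rw [hb.2] at this; exact this

theorem otype_lt {a : Set Ordinal.{0}} (ha : #a < Cardinal.lift.{1} κ) :
    ∃ o < κ.ord, otype a = Ordinal.lift.{1} o := by
  have : otype a < Ordinal.lift.{1} κ.ord := by
    rw [Cardinal.lift_ord, Cardinal.lt_ord]
    exact ha
  obtain ⟨o, ho, h⟩ := Ordinal.lt_lift_iff.1 this
  exact ⟨o, ho, h.symm⟩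

theorem Meas.ev_subTilde (h : Meas κ μ W) {a : Set Ordinal.{0}} (ha : a ∈ Pkm κ μ) :
    ∀ᶠ b in h.F, SubTilde κ a b := by
  obtain ⟨o, ho, hoa⟩ := otype_lt ha.2
  have h1 : ∀ᶠ b in h.F, ∀ x : a, x.1 ∈ b := h.ev_forall ha.2 fun x => h.ev_fine (ha.1 x.2)
  filter_upwards [h1, h.ev_C, h.ev_lt_C ho] with b hb1 hb2 hb3
  refine ⟨fun x hx => hb1 ⟨x, hx⟩, C κ b, hb2.1, hb2.2, ?_⟩
  rw [hoa]; exact Ordinal.lift_lt.2 hb3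

theorem Meas.press (h : Meas κ μ W) {g : Set Ordinal.{0} → Ordinal.{0}}
    (hg : ∀ᶠ b in h.F, g b < C κ b) : ∃ ξ < κ.ord, ∀ᶠ b in h.F, g b = ξ := by
  by_contra hcon
  have := h.neBot
  have hs : ∀ ξ < κ.ord, ∀ᶠ b in h.F, SubTilde κ {ξ} b := by
    intro ξ hξ
    refine h.ev_subTilde ⟨?_, ?_⟩
    · simpa using hξ.trans_le (ord_le_ord.2 h.le)
    · simpa using one_lt_aleph0.trans h.aleph0_lt
  have hn := h.ev_normal (P := fun a b => ∀ ξ < κ.ord, a = {ξ} → g b ≠ ξ) (by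
    intro a ha
    by_cases hx : ∃ ξ < κ.ord, a = {ξ}
    · obtain ⟨ξ, hξ, rfl⟩ := hx
      filter_upwards [(h.ev_or fun b => g b = ξ).resolve_left (fun hh => hcon ⟨ξ, hξ, hh⟩)] with b hb ξ' _ h'
      rw [Set.singleton_eq_singleton_iff] at h'
      rwa [← h']
    · push Not at hx
      exact Eventually.of_forall fun b ξ hξ h' => absurd h' (hx ξ hξ))
  have h1 : (1 : Ordinal) < κ.ord := by
    rw [Cardinal.lt_ord]; simpa using one_lt_aleph0.trans h.inacc.aleph0_lt
  obtain ⟨b, ⟨-, hb1⟩, hb2, hb3, hb4, hb5⟩ :=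
    (hn.and (hg.and (h.ev_C.and ((h.ev_lt_C h1).and h.ev_Pkm)))).exists
  have hm : g b ∈ b ∩ Set.Iio κ.ord := by rw [hb3.2]; exact hb2
  refine hb1 {g b} ⟨?_, ?_⟩ ⟨?_, C κ b, hb3.1, hb3.2, ?_⟩ (g b) hm.2 rfl rfl
  · simpa using hb5.1 hm.1
  · simpa using one_lt_aleph0.trans h.aleph0_lt
  · simpa using hm.1
  · rw [otype, Ordinal.type_eq_one_of_unique]
    rw [← Ordinal.lift_one.{0, 1}]
    exact Ordinal.lift_lt.2 hb4

theorem cofseq (c : Ordinal.{0}) : ∃ f : Ordinal.{0} → Ordinal.{0},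
    (∀ i < c.cof.ord, f i < c) ∧ ∀ y < c, ∃ i < c.cof.ord, y ≤ f i := by
  classical
  obtain ⟨s, hs, hs2⟩ := Order.exists_cof_eq (α := Set.Iio c)
  have : #s = #(Set.Iio c.cof.ord) := by
    rw [hs2, Ordinal.cof_Iio, Cardinal.mk_Iio_ordinal, card_ord, Ordinal.lift_cof]
  obtain ⟨e⟩ := Cardinal.eq.1 this
  refine ⟨fun i => if hi : i < c.cof.ord then (e.symm ⟨i, hi⟩).1.1 else 0, ?_, ?_⟩
  · intro i hi
    simp only [hi, dif_pos]
    exact (e.symm ⟨i, hi⟩).1.2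
  · intro y hy
    obtain ⟨x, hx, hyx⟩ := hs ⟨y, hy⟩
    refine ⟨(e ⟨x, hx⟩).1, (e ⟨x, hx⟩).2, ?_⟩
    beta_reduce
    rw [dif_pos (show (e ⟨x, hx⟩).1 < c.cof.ord from (e ⟨x, hx⟩).2)]
    have hyx' : y ≤ x.1 := hyx
    simpa using hyx'

theorem bound (hκ : κ.IsInaccessible) {δ : Ordinal.{0}} (hδ : δ < κ.ord)
    (e : Ordinal.{0} → Ordinal.{0}) (he : ∀ i < δ, e i < κ.ord) :
    ∃ S < κ.ord, ∀ i < δ, e i ≤ S := by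
  refine ⟨sSup (e '' Set.Iio δ), ?_, ?_⟩
  · apply Ordinal.sSup_lt_of_lt_cof
    · refine Cardinal.mk_image_le.trans_lt ?_
      rw [Cardinal.mk_Iio_ordinal, ← Ordinal.lift_cof, hκ.isRegular.cof_ord]
      exact Cardinal.lift_lt.2 (Cardinal.lt_ord.1 hδ)
    · rintro _ ⟨i, hi, rfl⟩
      exact he i hi
  · intro i hi
    refine le_csSup ⟨κ.ord, ?_⟩ ⟨i, hi, rfl⟩
    rintro _ ⟨i, hi, rfl⟩
    exact (he i hi).le

theorem inacc_of {c : Ordinal.{0}} (h0 : Ordinal.omega0 < c)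
    (h1 : ∀ x < c, ((2 : Cardinal) ^ x.card).ord < c) (h2 : c ≤ c.cof.ord) :
    c.cof.ord = c ∧ c.cof.IsInaccessible := by
  have he : c.cof.ord = c := le_antisymm (Ordinal.ord_cof_le c) h2
  refine ⟨he, ?_, ?_, ?_⟩
  · rw [← ord_lt_ord, he]; simpa using h0
  · rw [he]
  · intro x hx
    rw [← ord_lt_ord, he] at hx ⊢
    simpa using h1 _ hx

theorem Meas.ev_inacc (h : Meas κ μ W) : ∀ᶠ b in h.F,
    ∃ c : Cardinal.{0}, b ∩ Set.Iio κ.ord = Set.Iio c.ord ∧ c.IsInaccessible := by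
  have := h.neBot
  have e0 : ∀ᶠ b in h.F, Ordinal.omega0 < C κ b := h.ev_lt_C (by
    rw [Cardinal.lt_ord]; simpa using h.inacc.aleph0_lt)
  have e1 : ∀ᶠ b in h.F, ∀ x < C κ b, ((2 : Cardinal) ^ x.card).ord < C κ b := by
    refine (h.ev_or _).resolve_right fun hn => ?_
    have hn' : ∀ᶠ b in h.F, ∃ x < C κ b, C κ b ≤ ((2 : Cardinal) ^ x.card).ord := by
      refine hn.mono fun b hb => ?_
      push Not at hb; exact hb
    obtain ⟨g, hg⟩ : ∃ g : Set Ordinal.{0} → Ordinal.{0}, ∀ᶠ b in h.F,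
        g b < C κ b ∧ C κ b ≤ ((2 : Cardinal) ^ (g b).card).ord :=
      ⟨fun b => Classical.epsilon fun x => x < C κ b ∧ C κ b ≤ ((2 : Cardinal) ^ x.card).ord,
        hn'.mono fun b hb => Classical.epsilon_spec hb⟩
    obtain ⟨ξ, hξ, hc⟩ := h.press (hg.mono fun b hb => hb.1)
    have hlt : ((2 : Cardinal) ^ ξ.card).ord < κ.ord :=
      ord_lt_ord.2 (h.inacc.isStrongPrelimit (Cardinal.lt_ord.1 hξ))
    obtain ⟨b, hb1, hb2, hb3⟩ := (hg.and (hc.and (h.ev_lt_C hlt))).exists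
    rw [hb2] at hb1
    exact absurd hb3 (not_lt.2 hb1.2)
  have e2 : ∀ᶠ b in h.F, C κ b ≤ (C κ b).cof.ord := by
    refine (h.ev_or _).resolve_right fun hn => ?_
    obtain ⟨δ, hδ, hc⟩ := h.press (g := fun b => (C κ b).cof.ord)
      (hn.mono fun b hb => not_le.1 hb)
    choose f hf1 hf2 using cofseq
    have hp : ∀ i : Set.Iio δ, ∃ ξ < κ.ord, ∀ᶠ b in h.F, f (C κ b) i = ξ := by
      intro i
      refine h.press ?_
      filter_upwards [hc] with b hb
      exact hf1 _ _ (by rw [hb]; exact i.2)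
    choose e he1 he2 using hp
    have he3 := h.ev_forall (by
      rw [Cardinal.mk_Iio_ordinal]; exact Cardinal.lift_lt.2 (Cardinal.lt_ord.1 hδ)) he2
    classical
    obtain ⟨S, hS, hS2⟩ := bound h.inacc hδ (fun i => if hi : i < δ then e ⟨i, hi⟩ else 0) (by
      intro i hi; simp only [hi, dif_pos]; exact he1 _)
    have hS' : Order.succ S < κ.ord := (isSuccLimit_ord h.inacc.aleph0_lt.le).succ_lt hS
    obtain ⟨b, hb1, hb2, hb3⟩ := (hc.and (he3.and (h.ev_lt_C hS'))).exists
    obtain ⟨i, hi, hi2⟩ := hf2 _ _ hb3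
    rw [hb1] at hi
    have := hS2 i hi
    rw [dif_pos hi, ← hb2 ⟨i, hi⟩] at this
    exact absurd (hi2.trans this) (not_le.2 (Order.lt_succ S))
  filter_upwards [e0, e1, e2, h.ev_C] with b h0 h1 h2 h3
  obtain ⟨h4, h5⟩ := inacc_of h0 h1 h2
  exact ⟨_, by rw [h4]; exact h3.2, h5⟩

theorem card_lt (hκ : κ.IsInaccessible) {a : Set Ordinal.{0}} (ha : #a < Cardinal.lift.{1} κ) :
    #(ℕ × (ℕ → Set a)) < Cardinal.lift.{1} κ := by
  obtain ⟨x, hx, hxa⟩ := Cardinal.lt_lift_iff.1 ha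
  have h1 : (2 : Cardinal.{0}) ^ (x * ℵ₀) < κ :=
    hκ.isStrongPrelimit (Cardinal.mul_lt_of_lt hκ.aleph0_lt.le hx hκ.aleph0_lt)
  have h2 : ℵ₀ * (2 : Cardinal.{0}) ^ (x * ℵ₀) < κ :=
    Cardinal.mul_lt_of_lt hκ.aleph0_lt.le hκ.aleph0_lt h1
  have h3 := Cardinal.lift_lt.{0, 1}.2 h2
  refine lt_of_eq_of_lt ?_ h3
  simp [← hxa, Cardinal.power_mul]

theorem Meas.diag (h : Meas κ μ W) (A : ℕ → (ℕ → Set Ordinal.{0}) → Set Ordinal.{0} → Prop)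
    (hA : ∀ k s, ∀ᶠ b in h.F, A k s b) :
    ∀ᶠ b in h.F, ∀ k s, (∀ i, k ≤ i → s i = ∅) → (∀ i < k, s i ∈ Pkm κ μ) →
      (∀ i j, i < j → j < k → SubTilde κ (s i) (s j)) →
      (∀ i < k, SubTilde κ (s i) b) → A k s b := by
  have hB : ∀ a ∈ Pkm κ μ, ∀ᶠ b in h.F, ∀ k s, (∀ i, s i ⊆ a) → A k s b := by
    intro a ha
    have := h.ev_forall (card_lt h.inacc ha.2)
      (P := fun x b => A x.1 (fun i => Subtype.val '' (x.2 i)) b) (fun x => hA _ _)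
    refine this.mono fun b hb k s hs => ?_
    have h1 := hb (k, fun i => Subtype.val ⁻¹' (s i))
    have h2 : (fun i => (Subtype.val '' (Subtype.val ⁻¹' (s i) : Set a) : Set Ordinal.{0})) = s := by
      funext i
      rw [Subtype.image_preimage_coe]
      exact Set.inter_eq_right.2 (hs i)
    simp only [h2] at h1
    exact h1
  have h0 : (∅ : Set Ordinal.{0}) ∈ Pkm κ μ :=
    ⟨Set.empty_subset _, by simpa using aleph0_pos.trans h.aleph0_lt⟩
  filter_upwards [hB ∅ h0, h.ev_normal hB] with b hb1 hb2 k s hs1 hs2 hs3 hs4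
  cases k with
  | zero => exact hb1 _ _ fun i => (hs1 i (Nat.zero_le _)).subset
  | succ k =>
    refine hb2.2 (s k) (hs2 k (Nat.lt_succ_self k)) (hs4 k (Nat.lt_succ_self k)) _ _ ?_
    intro i
    rcases lt_trichotomy i k with hi | hi | hi
    · exact (hs3 i k hi (Nat.lt_succ_self k)).1
    · rw [hi]
    · rw [hs1 i hi]; exact Set.empty_subset _

section main

variable {ν : ℕ → Cardinal.{0}} {U : ℕ → Set (Set (Set Ordinal.{0}))}

/-- `G m k s`: almost surely `m` more points bring the stem `s` of length `k` into `D`. -/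
def G (hM : ∀ n, Meas κ (ν n) (U n)) (D : Set QCond) : ℕ → ℕ → (ℕ → Set Ordinal.{0}) → Prop
  | 0, k, s => ∃ X, (⟨k, s, X⟩ : QCond) ∈ D
  | m + 1, k, s => ∀ᶠ b in (hM k).F, G hM D m (k + 1) (Function.update s k b)

/-- The stem of `p ⊕ v` of length `k`, with normalised junk. -/
noncomputable def stem (p : QCond) (v : ℕ → Set Ordinal.{0}) (k : ℕ) : ℕ → Set Ordinal.{0} :=
  fun i => if i < k then (if i < p.n then p.a i else v i) else ∅

set_option maxHeartbeats 1000000 in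
theorem mainThm (hM : ∀ n, Meas κ (ν n) (U n)) (hν : Monotone ν)
    (p : QCond) (hp : QIsCond κ ν U p) (D : Set QCond) (hD : QDenseOpen κ ν U D) :
    ∃ q : QCond, QIsCond κ ν U q ∧ QDirExt q p ∧
      ∃ m : ℕ, ∀ v : ℕ → Set Ordinal.{0},
        GoodVec κ q v (q.n + m) → QOplus κ q v (q.n + m) ∈ D := by
  obtain ⟨hD1, hD2, hD3⟩ := hD
  obtain ⟨hp1, hp2, hp3, hp4⟩ := hp
  have hPk : ∀ i j, i ≤ j → Pkm κ (ν i) ⊆ Pkm κ (ν j) := fun i j hij a ha =>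
    ⟨fun x hx => (show x < (ν i).ord from ha.1 hx).trans_le (ord_le_ord.2 (hν hij)), ha.2⟩
  choose! XX hXX using fun k s (h : ∃ X, (⟨k, s, X⟩ : QCond) ∈ D) => h
  let A : ℕ → ℕ → (ℕ → Set Ordinal.{0}) → Set Ordinal.{0} → Prop := fun j k s b =>
    (k ≤ j → G hM D 0 k s → b ∈ XX k s j) ∧
    (k = j → ∀ m, (G hM D m (k + 1) (Function.update s k b) ↔ G hM D (m + 1) k s))
  have hA : ∀ j k s, ∀ᶠ b in (hM j).F, A j k s b := by
    intro j k s
    refine Filter.Eventually.and ?_ ?_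
    · by_cases hk : k ≤ j
      · by_cases hG : G hM D 0 k s
        · have := (hD1 _ (hXX k s hG)).2.1 j hk
          exact ((hM j).ev_of_mem this).mono fun b hb _ _ => hb
        · exact Eventually.of_forall fun b _ h => absurd h hG
      · exact Eventually.of_forall fun b h => absurd h hk
    · by_cases hk : k = j
      · subst hk
        have : ∀ᶠ b in (hM k).F, ∀ m,
            (G hM D m (k + 1) (Function.update s k b) ↔ G hM D (m + 1) k s) := by
          refine (hM k).ev_nat fun m => ?_
          by_cases hG : G hM D (m + 1) k s
          · exact Eventually.mono (show ∀ᶠ b in (hM k).F, _ from hG) fun b hb =>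
              ⟨fun _ => hG, fun _ => hb⟩
          · refine (((hM k).ev_or _).resolve_left (show ¬ ∀ᶠ b in (hM k).F, _ from hG)).mono
              fun b hb => ⟨fun h => absurd h hb, fun h => absurd h hG⟩
        exact this.mono fun b hb _ => hb
      · exact Eventually.of_forall fun b h => absurd h hk
  let q : QCond := ⟨p.n, p.a, fun j => {b ∈ Pkm κ (ν j) |
    (∀ k s, (∀ i, k ≤ i → s i = ∅) → (∀ i < k, s i ∈ Pkm κ (ν j)) →
      (∀ i j, i < j → j < k → SubTilde κ (s i) (s j)) →
      (∀ i < k, SubTilde κ (s i) b) → A j k s b) ∧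
    (∃ c : Cardinal.{0}, b ∩ Set.Iio κ.ord = Set.Iio c.ord ∧ c.IsInaccessible) ∧
    (p.n ≤ j → b ∈ p.X j)}⟩
  have hqX : ∀ j, q.X j ∈ U j := by
    intro j
    refine (hM j).ev_iff.1 ?_
    refine ((hM j).diag (A j) (hA j)).and ((hM j).ev_inacc.and ?_)
    by_cases hj : p.n ≤ j
    · exact ((hM j).ev_of_mem (hp2 j hj)).mono fun b hb _ => hb
    · exact Eventually.of_forall fun b h => absurd h hj
  have hq : QIsCond κ ν U q :=
    ⟨hp1, fun m _ => hqX m, fun m hm b hb l hl => hp3 m hm b (hb.2.2.2 hm) l hl, hp4⟩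
  have hqp : QDirExt q p := ⟨rfl, fun _ _ => rfl, fun m hm b hb => hb.2.2.2 hm⟩
  -- the oplus conditions
  have hop : ∀ v k, p.n ≤ k → GoodVec κ q v k → QIsCond κ ν U (QOplus κ q v k) := by
    intro v k hk ⟨hv1, hv2⟩
    refine ⟨?_, ?_, ?_, ?_⟩
    · intro l hl
      by_cases hln : l < p.n
      · have h1 : (QOplus κ q v k).a l = p.a l := if_pos hln
        rw [h1]
        exact hp1 l hln
      · have := hv1 l (not_lt.1 hln) hl
        have h1 : (QOplus κ q v k).a l = v l := if_neg hln
        rw [h1]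
        exact ⟨this.1, this.2.2.1⟩
    · intro m hm
      have hm' : k ≤ m := hm
      have h1 : ∀ᶠ b in (hM m).F, ∀ i, p.n ≤ i → i < k → SubTilde κ (v i) b := by
        refine (hM m).ev_nat fun i => ?_
        by_cases hi : p.n ≤ i ∧ i < k
        · exact ((hM m).ev_subTilde (hPk i m (by omega) (hv1 i hi.1 hi.2).1)).mono
            fun b hb _ _ => hb
        · exact Eventually.of_forall fun b h1 h2 => absurd ⟨h1, h2⟩ hi
      have h2 := (hM m).ev_iff.1 (((hM m).ev_of_mem (hqX m)).and h1)
      convert h2 using 1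
      ext b
      constructor
      · exact fun hb => ⟨hb.1.1, hb.1, hb.2⟩
      · exact fun hb => ⟨hb.2.1, hb.2.2⟩
    · intro m hm b hb l hl
      have hl' : l < k := hl
      have hm' : k ≤ m := hm
      by_cases hln : l < p.n
      · have h1 : (QOplus κ q v k).a l = p.a l := if_pos (hln)
        rw [h1]
        exact hp3 m (by omega) b (hb.1.2.2.2 (by omega)) l hln
      · have h1 : (QOplus κ q v k).a l = v l := if_neg hln
        rw [h1]
        exact hb.2 l (not_lt.1 hln) hl'
    · intro i j hij hj
      have hj' : j < k := hj
      by_cases hjn : j < p.n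
      · have h1 : (QOplus κ q v k).a j = p.a j := if_pos (hjn)
        have h2 : (QOplus κ q v k).a i = p.a i := if_pos (hij.trans hjn)
        rw [h1, h2]
        exact hp4 i j hij hjn
      · have h1 : (QOplus κ q v k).a j = v j := if_neg hjn
        rw [h1]
        by_cases hin : i < p.n
        · have h2 : (QOplus κ q v k).a i = p.a i := if_pos (hin)
          rw [h2]
          exact hp3 j (not_lt.1 hjn) _ ((hv1 j (not_lt.1 hjn) hj').2.2.2 (not_lt.1 hjn)) i hin
        · have h2 : (QOplus κ q v k).a i = v i := if_neg hin
          rw [h2]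
          exact hv2 i j (not_lt.1 hin) hij hj'
  have hst : ∀ v k i, i < k → stem p v k i = (QOplus κ q v k).a i := by
    intro v k i hi
    exact if_pos hi
  -- elements above a good stem
  have hAb : ∀ v k, p.n ≤ k → GoodVec κ q v k → ∀ j, k ≤ j → ∀ b ∈ (QOplus κ q v k).X j,
      A j k (stem p v k) b := by
    intro v k hk hv j hj b hb
    obtain ⟨c1, c2, c3, c4⟩ := hop v k hk hv
    refine hb.1.2.1 k (stem p v k) ?_ ?_ ?_ ?_
    · intro i hi
      simp [stem, not_lt.2 hi]
    · intro i hi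
      rw [hst v k i hi]
      exact hPk i j (by omega) (c1 i hi).1
    · intro i i' hii hi
      rw [hst v k i (hii.trans hi), hst v k i' hi]
      exact c4 i i' hii hi
    · intro i hi
      rw [hst v k i hi]
      exact c3 j hj b hb i hi
  have hmono : ∀ v k k', k ≤ k' → GoodVec κ q v k' → GoodVec κ q v k :=
    fun v k k' hk hv => ⟨fun i h1 h2 => hv.1 i h1 (h2.trans_le hk),
      fun i j h1 h2 h3 => hv.2 i j h1 h2 (h3.trans_le hk)⟩
  have hstep : ∀ v m k, p.n ≤ k → GoodVec κ q v (k + 1) →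
      (G hM D m (k + 1) (stem p v (k + 1)) ↔ G hM D (m + 1) k (stem p v k)) := by
    intro v m k hk hv
    have hb : v k ∈ (QOplus κ q v k).X k :=
      ⟨hv.1 k hk (Nat.lt_succ_self k), fun i h1 h2 => hv.2 i k h1 h2 (Nat.lt_succ_self k)⟩
    have := (hAb v k hk (hmono v k _ (Nat.le_succ k) hv) k le_rfl _ hb).2 rfl m
    rw [← this]
    have he : stem p v (k + 1) = Function.update (stem p v k) k (v k) := by
      funext i
      by_cases hi : i = k
      · subst hi
        simp [stem, not_lt.2 hk]
      · have : i < k + 1 ↔ i < k := by omega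
        simp [stem, hi, this]
    rw [he]
  have hall : ∀ v d m, GoodVec κ q v (p.n + d) →
      (G hM D m (p.n + d) (stem p v (p.n + d)) ↔ G hM D (m + d) p.n (stem p v p.n)) := by
    intro v d
    induction d with
    | zero => intro m _; rfl
    | succ d ih =>
      intro m hv
      rw [show p.n + (d + 1) = p.n + d + 1 by omega] at hv ⊢
      rw [hstep v m _ (by omega) hv, ih (m + 1) (hmono v _ _ (Nat.le_succ _) hv),
        show m + (d + 1) = m + 1 + d by omega]
  have hbase : ∀ v w, stem p v p.n = stem p w p.n := by
    intro v w
    funext i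
    by_cases hi : i < p.n <;> simp [stem, hi]
  -- density
  obtain ⟨r, hrD, hr⟩ := hD2 q hq
  obtain ⟨v, k, hk, hv, hrv⟩ : ∃ v k, p.n ≤ k ∧ GoodVec κ q v k ∧
      QDirExt r (QOplus κ q v k) := by
    rcases hr with hr | ⟨v, k, hk, hv, hr⟩
    · refine ⟨fun _ => ∅, p.n, le_rfl, ⟨?_, ?_⟩, hr.1, ?_, ?_⟩
      · intro i h1 h2; exact absurd h1 (not_le.2 h2)
      · intro i j h1 h2 h3; exact absurd h1 (not_le.2 (h2.trans h3))
      · intro l hl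
        have hl' : l < p.n := hl
        rw [hr.2.1 l hl]
        exact (if_pos hl').symm
      · intro m hm b hb
        exact ⟨hr.2.2 m hm hb, fun i h1 h2 => absurd h1 (not_le.2 h2)⟩
    · exact ⟨v, k, hk, hv, hr⟩
  have hrn : r.n = k := hrv.1
  have hG0 : G hM D 0 k (stem p v k) := by
    obtain ⟨r1, r2, r3, r4⟩ := hD1 r hrD
    have ha : ∀ l < k, stem p v k l = r.a l := fun l hl => by
      rw [hst v k l hl]; exact (hrv.2.1 l hl).symm
    rw [hrn] at r1 r2 r3 r4
    refine ⟨r.X, hD3 r hrD _ ⟨?_, r2, ?_, ?_⟩ (Or.inl ⟨hrn.symm, ?_, fun _ _ => subset_rfl⟩)⟩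
    · intro l hl
      show stem p v k l ∈ _ ∧ ∃ c : Cardinal.{0}, stem p v k l ∩ _ = _ ∧ _
      rw [ha l hl]; exact r1 l hl
    · intro m hm b hb l hl
      show SubTilde κ (stem p v k l) b
      rw [ha l hl]; exact r3 m hm b hb l hl
    · intro i j hij hj
      show SubTilde κ (stem p v k i) (stem p v k j)
      rw [ha j hj, ha i (hij.trans hj)]; exact r4 i j hij hj
    · intro l hl
      exact ha l (hrn ▸ hl)
  refine ⟨q, hq, hqp, k - p.n, fun w hw => ?_⟩
  have hw' : GoodVec κ q w (p.n + (k - p.n)) := hw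
  have e : p.n + (k - p.n) = k := by omega
  have h1 := hall v (k - p.n) 0 (by rwa [e])
  have h2 := hall w (k - p.n) 0 hw'
  rw [e] at h1 h2 hw'
  have hGw : G hM D 0 k (stem p w k) := by
    rw [h2, hbase w v, ← h1]; exact hG0
  show QOplus κ q w (p.n + (k - p.n)) ∈ D
  rw [e]
  refine hD3 _ (hXX k _ hGw) _ (hop w k hk hw') (Or.inl ⟨rfl, ?_, ?_⟩)
  · intro l hl
    exact (hst w k l hl).symm
  · intro m hm b hb
    exact (hAb w k hk hw' m hm b hb).1 hm hGw

end main

end DPrikry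

/-- the diagonal supercompact Prikry forcing built from κ-complete
fine normal ultrafilters `U n` on `𝒫_κ(κ⁺ⁿ)` satisfies the *-Prikry condition:
for every condition `p` and dense open `D` there are a direct extension
`q ≤* p` and `m : ℕ` such that `q ⊕ v ∈ D` for every admissible vector `v`
extending `q` to length `l(q) + m`. -/
theorem diagPrikry_star_condition (κ : Cardinal.{0}) (hκ : κ.IsInaccessible)
    (U : ℕ → Set (Set (Set Ordinal.{0})))
    (hU : ∀ n : ℕ, DIsUltra κ ((Order.succ)^[n] κ) (U n) ∧
      DComplete κ ((Order.succ)^[n] κ) (U n) ∧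
      DFine κ ((Order.succ)^[n] κ) (U n) ∧
      DNormal κ ((Order.succ)^[n] κ) (U n))
    (p : QCond) (hp : QIsCond κ (fun n => (Order.succ)^[n] κ) U p)
    (D : Set QCond) (hD : QDenseOpen κ (fun n => (Order.succ)^[n] κ) U D) :
    ∃ q : QCond, QIsCond κ (fun n => (Order.succ)^[n] κ) U q ∧ QDirExt q p ∧
      ∃ m : ℕ, ∀ v : ℕ → Set Ordinal.{0},
        GoodVec κ q v (q.n + m) → QOplus κ q v (q.n + m) ∈ D := by
  have hmono : Monotone (fun n : ℕ => (Order.succ)^[n] κ) := by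
    refine monotone_nat_of_le_succ fun n => ?_
    simp only [Function.iterate_succ_apply']
    exact Order.le_succ _
  have hM : ∀ n : ℕ, DPrikry.Meas κ ((Order.succ)^[n] κ) (U n) := fun n =>
    ⟨hκ, hmono (Nat.zero_le n), (hU n).1, (hU n).2.1, (hU n).2.2.1, (hU n).2.2.2⟩
  exact DPrikry.mainThm (ν := fun n => (Order.succ)^[n] κ) hM hmono p hp D hD
end

section
/- Let κ be an inaccessible cardinal and for each n < ω let U_n be a κ-complete fine normal ultrafilter on 𝒫_κ(κ^{+n}). Then the diagonal supercompact Prikry forcing ℚ, equipped with the length function l(p) = (number of finite components of p), is κ-geometric. -/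
abbrev SO := Set Ordinal.{0}

/-- the measure hypotheses -/
def HU (κ : Cardinal.{0}) (μ : ℕ → Cardinal.{0}) (U : ℕ → Set (Set SO)) : Prop :=
  ∀ n, DIsUltra κ (μ n) (U n) ∧ DComplete κ (μ n) (U n) ∧ DNormal κ (μ n) (U n)

/-- patch `a` by `v` on `[n,m)` -/
def pv (a : ℕ → SO) (n : ℕ) (v : ℕ → SO) (m : ℕ) : ℕ → SO :=
  fun i => if n ≤ i ∧ i < m then v i else a i

theorem pv_self (a : ℕ → SO) (n : ℕ) (v : ℕ → SO) : pv a n v n = a := by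
  funext i
  unfold pv
  rw [if_neg (by omega)]

theorem pv_succ (a : ℕ → SO) (n : ℕ) (v : ℕ → SO) (m : ℕ) (h : n ≤ m) :
    Function.update (pv a n v m) m (v m) = pv a n v (m+1) := by
  funext i
  by_cases hi : i = m
  · subst hi; simp [pv, h]
  · rw [Function.update_of_ne hi]
    unfold pv
    have : (n ≤ i ∧ i < m) ↔ (n ≤ i ∧ i < m + 1) := by omega
    simp only [this]

theorem fuse_aux {κ : Cardinal.{0}} {μ : Cardinal.{0}} {W : Set (Set SO)}
    (h1 : DIsUltra κ μ W) (h2 : DNormal κ μ W) (j : ℕ)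
    (A : ℕ → (ℕ → SO) → Set SO) (hA : ∀ n ≤ j, ∀ a, A n a ∈ W) :
    ∀ d n, n + d = j → ∀ a : ℕ → SO, ∃ B ∈ W, ∀ b ∈ B, ∀ m, n ≤ m → m ≤ j → ∀ v : ℕ → SO,
      (∀ i < n, v i = a i) → (∀ i, m ≤ i → v i = a i) →
      (∀ i, n ≤ i → i < m → v i ∈ Pkm κ μ ∧ SubTilde κ (v i) b) → b ∈ A m v := by
  obtain ⟨u1, u2, u3, u4, u5, u6⟩ := h1
  intro d
  induction d with
  | zero =>
    intro n hn a
    refine ⟨A n a, hA n (by omega) a, ?_⟩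
    intro b hb m hm hmj v hv1 hv2 _
    have : m = n := by omega
    subst this
    have : v = a := by
      funext i
      rcases lt_or_ge i m with h | h
      · exact hv1 i h
      · exact hv2 i h
    rw [this]; exact hb
  | succ d ih =>
    intro n hn a
    choose B hB hB' using fun x : SO => ih (n+1) (by omega) (Function.update a n x)
    refine ⟨_, u5 _ _ (hA n (by omega) a) (h2 B (fun x _ => hB x)), ?_⟩
    rintro b ⟨hb1, hb2, _, hb3⟩ m hm hmj v hv1 hv2 hv3
    rcases Nat.eq_or_lt_of_le hm with h | h
    · subst h
      have : v = a := by
        funext i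
        rcases lt_or_ge i n with h | h
        · exact hv1 i h
        · exact hv2 i h
      rw [this]; exact hb1
    · have hx := hv3 n le_rfl h
      refine hB' (v n) b (hb3 (v n) hx.1 hx.2) m h hmj v ?_ ?_ ?_
      · intro i hi
        by_cases hi' : i = n
        · subst hi'; simp
        · rw [Function.update_of_ne hi']; exact hv1 i (by omega)
      · intro i hi
        rw [Function.update_of_ne (by omega)]; exact hv2 i hi
      · intro i hi hi2
        exact hv3 i (by omega) hi2

theorem fuse {κ : Cardinal.{0}} {μ : ℕ → Cardinal.{0}} {U : ℕ → Set (Set SO)}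
    (hU : HU κ μ U) (hμ : ∀ i j, i ≤ j → Pkm κ (μ i) ⊆ Pkm κ (μ j))
    (A : ℕ → (ℕ → SO) → ℕ → Set SO) (hA : ∀ n a j, n ≤ j → A n a j ∈ U j)
    (p : QCond) (hp : QIsCond κ μ U p) :
    ∃ q, QIsCond κ μ U q ∧ QDirExt q p ∧ q.a = p.a ∧ q.n = p.n ∧
      ∀ m, p.n ≤ m → ∀ v, GoodVec κ q v m → ∀ j, m ≤ j → ∀ b ∈ q.X j,
        (∀ i, p.n ≤ i → i < m → SubTilde κ (v i) b) → b ∈ A m (pv p.a p.n v m) j := by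
  have key : ∀ j, ∃ B : Set SO, p.n ≤ j → B ∈ U j ∧ ∀ b ∈ B, ∀ m, p.n ≤ m → m ≤ j →
      ∀ v : ℕ → SO,
      (∀ i < p.n, v i = p.a i) → (∀ i, m ≤ i → v i = p.a i) →
      (∀ i, p.n ≤ i → i < m → v i ∈ Pkm κ (μ j) ∧ SubTilde κ (v i) b) → b ∈ A m v j := by
    intro j
    by_cases hj : p.n ≤ j
    · obtain ⟨B, hB, h⟩ := fuse_aux (hU j).1 (hU j).2.2 j (fun n a => A n a j)
        (fun n hn a => hA n a j hn) (j - p.n) p.n (by omega) p.a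
      exact ⟨B, fun _ => ⟨hB, h⟩⟩
    · exact ⟨∅, fun h => absurd h hj⟩
  choose B hB using key
  obtain ⟨c1, c2, c3, c4⟩ := hp
  have hX : ∀ m, p.n ≤ m → p.X m ∩ B m ∈ U m := fun m hm =>
    (hU m).1.2.2.2.2.1 _ _ (c2 m hm) (hB m hm).1
  refine ⟨⟨p.n, p.a, fun j => p.X j ∩ B j⟩, ⟨c1, hX, ?_, c4⟩,
    ⟨rfl, fun _ _ => rfl, fun m _ => Set.inter_subset_left⟩, rfl, rfl, ?_⟩
  · intro m hm b hb l hl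
    exact c3 m hm b hb.1 l hl
  · intro m hm v hv j hj b hb hvb
    refine (hB j (by omega)).2 b hb.2 m hm hj _ ?_ ?_ ?_
    · intro i hi
      unfold pv; rw [if_neg (by omega)]
    · intro i hi
      unfold pv; rw [if_neg (by omega)]
    · intro i hi hi2
      have : pv p.a p.n v m i = v i := by unfold pv; rw [if_pos ⟨hi, hi2⟩]
      rw [this]
      exact ⟨hμ i j (by omega) ((hU i).1.1 _ (hX i hi) (hv.1 i hi hi2)), hvb i hi hi2⟩

theorem ext_norm {κ : Cardinal.{0}} {t q : QCond} (h : QExt κ t q) :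
    ∃ v : ℕ → SO, ∃ m : ℕ, q.n ≤ m ∧ GoodVec κ q v m ∧ QDirExt t (QOplus κ q v m) := by
  rcases h with h | h
  · refine ⟨q.a, q.n, le_rfl, ⟨fun i h1 h2 => by omega, fun i j h1 h2 h3 => by omega⟩, ?_⟩
    refine ⟨h.1, ?_, ?_⟩
    · intro l hl
      have hl' : l < q.n := hl
      simp only [QOplus, if_pos hl']
      exact h.2.1 l hl'
    · intro m hm b hb
      exact ⟨h.2.2 m hm hb, fun i h1 h2 => by omega⟩
  · exact h

theorem dirExt_stem {κ : Cardinal.{0}} {t q : QCond} {v : ℕ → SO} {m : ℕ}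
    (h : QDirExt t (QOplus κ q v m)) (l : ℕ) (hl : l < m) :
    t.a l = pv q.a q.n v m l := by
  rw [h.2.1 l hl]
  simp only [QOplus, pv]
  by_cases h' : l < q.n
  · rw [if_pos h', if_neg (by omega)]
  · rw [if_neg h', if_pos (by omega)]

/-- `k`-goodness of stems -/
def Good (U : ℕ → Set (Set SO)) (P : ℕ → Set SO) (D : Set QCond) : ℕ → ℕ → (ℕ → SO) → Prop
  | 0, n, a => ∃ W ∈ D, W.n = n ∧ ∀ l < n, W.a l = a l
  | k+1, n, a => {b ∈ P n | Good U P D k (n+1) (Function.update a n b)} ∈ U n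

theorem countable_inter {κ : Cardinal.{0}} (hκ : κ.IsInaccessible) {μ : Cardinal.{0}}
    {W : Set (Set SO)} (h1 : DIsUltra κ μ W) (h2 : DComplete κ μ W)
    (f : ℕ → Set SO) (hf : ∀ k, f k ∈ W) : {b ∈ Pkm κ μ | ∀ k, b ∈ f k} ∈ W := by
  classical
  have hω : Ordinal.omega0 < κ.ord := by
    rw [← Cardinal.ord_aleph0]
    exact Cardinal.ord_lt_ord.2 hκ.aleph0_lt
  have := h2 Ordinal.omega0 hω
    (fun o => if h : ∃ k : ℕ, (k : Ordinal) = o then f h.choose else Pkm κ μ) (by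
      intro i _
      beta_reduce
      split_ifs
      · exact hf _
      · exact h1.2.1)
  refine h1.2.2.2.1 _ _ this ?_ (fun b hb => hb.1)
  rintro b ⟨hb1, hb2⟩
  refine ⟨hb1, fun k => ?_⟩
  have h := Set.mem_iInter₂.1 hb2 (k : Ordinal) (Ordinal.natCast_lt_omega0 k)
  have he : ∃ k' : ℕ, (k' : Ordinal.{0}) = (k : Ordinal) := ⟨k, rfl⟩
  rw [dif_pos he] at h
  have h3 := he.choose_spec
  have h4 : he.choose = k := by exact_mod_cast h3
  rw [h4] at h
  exact h

theorem exists_good {κ : Cardinal.{0}} (hκ : κ.IsInaccessible) {μ : ℕ → Cardinal.{0}}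
    {U : ℕ → Set (Set SO)}
    (hU : HU κ μ U) (hμ : ∀ i j, i ≤ j → Pkm κ (μ i) ⊆ Pkm κ (μ j))
    {D : Set QCond} (hD : QDenseOpen κ μ U D) (p : QCond) (hp : QIsCond κ μ U p) :
    ∃ k, Good U (fun n => Pkm κ (μ n)) D k p.n p.a := by
  classical
  by_contra hbad
  push Not at hbad
  set G := Good U (fun n => Pkm κ (μ n)) D with hG
  let A : ℕ → (ℕ → SO) → ℕ → Set SO := fun n a j =>
    {b ∈ Pkm κ (μ j) | j = n → (∀ k, ¬ G k n a) → ∀ k, ¬ G k (n+1) (Function.update a n b)}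
  have hA : ∀ n a j, n ≤ j → A n a j ∈ U j := by
    intro n a j _
    obtain ⟨u1, u2, u3, u4, u5, u6⟩ := (hU j).1
    by_cases h : j = n ∧ ∀ k, ¬ G k n a
    · obtain ⟨rfl, h⟩ := h
      have := countable_inter hκ (hU j).1 (hU j).2.1
        (fun k => Pkm κ (μ j) \ {b ∈ Pkm κ (μ j) | G k (j+1) (Function.update a j b)}) (by
          intro k
          rcases u6 {b ∈ Pkm κ (μ j) | G k (j+1) (Function.update a j b)} (fun b hb => hb.1)
            with h' | h'
          · exact absurd h' (h (k+1))
          · exact h')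
      refine u4 _ _ this ?_ (fun b hb => hb.1)
      rintro b ⟨hb1, hb2⟩
      exact ⟨hb1, fun _ _ k hk => (hb2 k).2 ⟨hb1, hk⟩⟩
    · refine u4 _ _ u2 ?_ (fun b hb => hb.1)
      intro b hb
      exact ⟨hb, fun h1 h2 => absurd ⟨h1, h2⟩ h⟩
  obtain ⟨q, hq, hqp, hqa, hqn, hf⟩ := fuse hU hμ A hA p hp
  obtain ⟨t, htD, htq⟩ := hD.2.1 q hq
  obtain ⟨v, m, hm, hv, ht⟩ := ext_norm htq
  rw [hqn] at hm
  have hall : ∀ m', p.n ≤ m' → m' ≤ m → ∀ k, ¬ G k m' (pv p.a p.n v m') := by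
    intro m' hm'
    induction m', hm' using Nat.le_induction with
    | base => intro _; rw [pv_self]; exact hbad
    | succ m' h1 ih =>
      intro h2
      have := hf m' h1 v ⟨fun i a b => hv.1 i a (by omega),
        fun i j a b c => hv.2 i j a b (by omega)⟩ m' le_rfl (v m')
        (hv.1 m' (by omega) (by omega))
        (fun i a b => hv.2 i m' (by omega) b (by omega))
      have h3 := this.2 rfl (ih (by omega))
      rw [pv_succ _ _ _ _ h1] at h3
      exact h3
  refine hall m hm le_rfl 0 ⟨t, htD, ht.1, ?_⟩
  intro l hl
  rw [dirExt_stem ht l hl, hqa, hqn]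

theorem strong_prikry {κ : Cardinal.{0}} (hκ : κ.IsInaccessible) {μ : ℕ → Cardinal.{0}}
    {U : ℕ → Set (Set SO)}
    (hU : HU κ μ U) (hμ : ∀ i j, i ≤ j → Pkm κ (μ i) ⊆ Pkm κ (μ j))
    {D : Set QCond} (hD : QDenseOpen κ μ U D) (p : QCond) (hp : QIsCond κ μ U p) :
    ∃ q, QIsCond κ μ U q ∧ QDirExt q p ∧ q.a = p.a ∧ q.n = p.n ∧
      ∃ N, ∀ t, QIsCond κ μ U t → QExt κ t q → N ≤ t.n → t ∈ D := by
  classical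
  obtain ⟨k, hk⟩ := exists_good hκ hU hμ hD p hp
  set G := Good U (fun n => Pkm κ (μ n)) D with hG
  let N := p.n + k
  let A : ℕ → (ℕ → SO) → ℕ → Set SO := fun n a j =>
    {b ∈ Pkm κ (μ j) | ∀ k', j = n ∧ n + (k'+1) = N ∧ G (k'+1) n a →
      G k' (n+1) (Function.update a n b)} ∩
    {b ∈ Pkm κ (μ j) | ∀ h : ∃ W ∈ D, W.n = n ∧ ∀ l < n, W.a l = a l, b ∈ h.choose.X j}
  have hA : ∀ n a j, n ≤ j → A n a j ∈ U j := by
    intro n a j hnj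
    obtain ⟨u1, u2, u3, u4, u5, u6⟩ := (hU j).1
    refine u5 _ _ ?_ ?_
    · by_cases h : ∃ k', j = n ∧ n + (k'+1) = N ∧ G (k'+1) n a
      · obtain ⟨k', rfl, h1, h2⟩ := h
        have h2' : {b ∈ Pkm κ (μ j) | G k' (j+1) (Function.update a j b)} ∈ U j := h2
        refine u4 _ _ h2' ?_ (fun b hb => hb.1)
        rintro b ⟨hb1, hb2⟩
        refine ⟨hb1, ?_⟩
        rintro k'' ⟨_, h3, _⟩
        have : k'' = k' := by omega
        rw [this]; exact hb2
      · refine u4 _ _ u2 ?_ (fun b hb => hb.1)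
        intro b hb
        exact ⟨hb, fun k' h' => absurd ⟨k', h'⟩ h⟩
    · by_cases h : ∃ W ∈ D, W.n = n ∧ ∀ l < n, W.a l = a l
      · have hc := h.choose_spec
        have hX : h.choose.X j ∈ U j := (hD.1 _ hc.1).2.1 j (by rw [hc.2.1]; exact hnj)
        exact u4 _ _ hX (fun b hb => ⟨u1 _ hX hb, fun _ => hb⟩) (fun b hb => hb.1)
      · exact u4 _ _ u2 (fun b hb => ⟨hb, fun h' => absurd h' h⟩) (fun b hb => hb.1)
  obtain ⟨q, hq, hqp, hqa, hqn, hf⟩ := fuse hU hμ A hA p hp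
  refine ⟨q, hq, hqp, hqa, hqn, N, ?_⟩
  intro t htc htq hNt
  obtain ⟨v, m, hm, hv, ht⟩ := ext_norm htq
  rw [hqn] at hm
  have hNm : N ≤ m := by
    have : t.n = m := ht.1
    omega
  have hgv : ∀ m' ≤ m, GoodVec κ q v m' := fun m' h => ⟨fun i a b => hv.1 i a (by omega),
        fun i j a b c => hv.2 i j a b (by omega)⟩
  have hall : ∀ d, d ≤ k → G (k - d) (p.n + d) (pv p.a p.n v (p.n + d)) := by
    intro d
    induction d with
    | zero => intro _; simp only [add_zero, Nat.sub_zero]; rw [pv_self]; exact hk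
    | succ d ih =>
      intro h2
      have := hf (p.n + d) (by omega) v (hgv _ (by omega)) (p.n + d) le_rfl (v (p.n + d))
        (hv.1 _ (by omega) (by omega))
        (fun i a b => hv.2 i _ (by omega) b (by omega))
      have e : k - d = (k - (d+1)) + 1 := by omega
      have ih' := ih (by omega)
      rw [e] at ih'
      have h3 := this.1.2 (k - (d+1)) ⟨rfl, by omega, ih'⟩
      rw [pv_succ _ _ _ _ (by omega)] at h3
      exact h3
  have h0 := hall k le_rfl
  rw [Nat.sub_self] at h0
  have h0' : ∃ W ∈ D, W.n = N ∧ ∀ l < N, W.a l = pv p.a p.n v N l := h0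
  obtain ⟨W, hW⟩ : ∃ W, W = h0'.choose := ⟨_, rfl⟩
  have hWX : ∀ j, N ≤ j → ∀ b ∈ q.X j, (∀ i, p.n ≤ i → i < N → SubTilde κ (v i) b) →
      b ∈ W.X j := by
    intro j hj b hb hvb
    rw [hW]
    exact (hf N (by omega) v (hgv N hNm) j hj b hb hvb).2.2 h0'
  obtain ⟨hWD, hWn, hWa⟩ := h0'.choose_spec
  rw [← hW] at hWD hWn hWa
  refine hD.2.2 W hWD t htc (Or.inr ⟨v, m, by omega, ⟨?_, ?_⟩, ht.1, ?_, ?_⟩)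
  · intro i hi hi2
    exact hWX i (by omega) (v i) (hv.1 i (by omega) hi2)
      (fun i' a b => hv.2 i' i (by omega) (by omega) hi2)
  · intro i j hi hij hj
    exact hv.2 i j (by omega) hij hj
  · intro l hl
    have hl' : l < m := hl
    rw [dirExt_stem ht l hl', hqa, hqn]
    simp only [QOplus]
    by_cases h : l < W.n
    · rw [if_pos h, hWa l (by omega)]
      have : (p.n ≤ l ∧ l < m) ↔ (p.n ≤ l ∧ l < N) := by omega
      simp only [pv, this]
    · rw [if_neg h]
      unfold pv; rw [if_pos (by omega)]
  · intro j hj b hb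
    have hj' : m ≤ j := hj
    have := ht.2.2 j hj hb
    refine ⟨hWX j (by omega) b this.1 (fun i a c => this.2 i (by omega) (by omega)), ?_⟩
    intro i hi hi2
    exact this.2 i (by omega) hi2

theorem Pkm_mono (κ : Cardinal.{0}) (i j : ℕ) (h : i ≤ j) :
    Pkm κ ((Order.succ)^[i] κ) ⊆ Pkm κ ((Order.succ)^[j] κ) := by
  have hm : Monotone (fun n : ℕ => (Order.succ)^[n] κ) := by
    refine monotone_nat_of_le_succ fun n => ?_
    rw [Function.iterate_succ_apply']
    exact Order.le_succ _
  rintro a ⟨h1, h2⟩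
  refine ⟨fun x hx => ?_, h2⟩
  exact lt_of_lt_of_le (h1 hx) (Cardinal.ord_le_ord.2 (hm h))

/-- the diagonal supercompact Prikry forcing built from κ-complete
fine normal ultrafilters `U n` on `𝒫_κ(κ⁺ⁿ)`, with length function
`l p = p.n`, is κ-geometric. -/
theorem diagPrikry_kappa_geometric (κ : Cardinal.{0}) (hκ : κ.IsInaccessible)
    (U : ℕ → Set (Set (Set Ordinal.{0})))
    (hU : ∀ n : ℕ, DIsUltra κ ((Order.succ)^[n] κ) (U n) ∧
      DComplete κ ((Order.succ)^[n] κ) (U n) ∧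
      DFine κ ((Order.succ)^[n] κ) (U n) ∧
      DNormal κ ((Order.succ)^[n] κ) (U n)) :
    ∀ γ < κ.ord, ∀ D : Ordinal.{0} → Set QCond,
      (∀ β < γ, QDenseOpen κ (fun n => (Order.succ)^[n] κ) U (D β)) →
      ∀ p, QIsCond κ (fun n => (Order.succ)^[n] κ) U p →
        ∃ q, QIsCond κ (fun n => (Order.succ)^[n] κ) U q ∧ QExt κ q p ∧
          ∀ F : Set QCond, QIsFilter κ (fun n => (Order.succ)^[n] κ) U F → q ∈ F →
            (∀ n : ℕ, ∃ r ∈ F, n < r.n) →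
            ∀ β < γ, ∃ r ∈ F, r ∈ D β := by
  intro γ hγ D hD p hp
  have hU' : HU κ (fun n => (Order.succ)^[n] κ) U :=
    fun n => ⟨(hU n).1, (hU n).2.1, (hU n).2.2.2⟩
  have key : ∀ β, ∃ q : QCond, β < γ → QIsCond κ (fun n => (Order.succ)^[n] κ) U q ∧
      QDirExt q p ∧ q.a = p.a ∧ q.n = p.n ∧
      ∃ N, ∀ t, QIsCond κ (fun n => (Order.succ)^[n] κ) U t → QExt κ t q → N ≤ t.n → t ∈ D β := by
    intro β
    by_cases h : β < γ
    · obtain ⟨q, hq⟩ := strong_prikry hκ hU' (Pkm_mono κ) (hD β h) p hp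
      exact ⟨q, fun _ => hq⟩
    · exact ⟨p, fun h' => absurd h' h⟩
  choose Q hQ using key
  obtain ⟨c1, c2, c3, c4⟩ := hp
  have hX : ∀ m, p.n ≤ m →
      p.X m ∩ (Pkm κ ((Order.succ)^[m] κ) ∩ ⋂ i ∈ Set.Iio γ, (Q i).X m) ∈ U m := by
    intro m hm
    refine (hU m).1.2.2.2.2.1 _ _ (c2 m hm) ((hU m).2.1 γ hγ (fun i => (Q i).X m) ?_)
    intro i hi
    obtain ⟨a1, a2, a3, a4, a5⟩ := hQ i hi
    exact a1.2.1 m (by omega)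
  refine ⟨⟨p.n, p.a, fun m =>
    p.X m ∩ (Pkm κ ((Order.succ)^[m] κ) ∩ ⋂ i ∈ Set.Iio γ, (Q i).X m)⟩,
    ⟨c1, hX, fun m hm b hb l hl => c3 m hm b hb.1 l hl, c4⟩,
    Or.inl ⟨rfl, fun _ _ => rfl, fun m _ => Set.inter_subset_left⟩, ?_⟩
  intro F hF hqF hlong β hβ
  obtain ⟨a1, a2, a3, a4, N, hN⟩ := hQ β hβ
  have hQF : Q β ∈ F := by
    refine hF.2.2.1 _ hqF _ a1 (Or.inl ⟨a4.symm, fun l _ => by rw [a3], ?_⟩)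
    intro m hm b hb
    exact Set.mem_iInter₂.1 hb.2.2 β hβ
  obtain ⟨r, hr, hrN⟩ := hlong N
  obtain ⟨t, htF, ht1, ht2⟩ := hF.2.2.2 _ hQF r hr
  refine ⟨t, htF, hN t (hF.2.1 t htF) ht1 ?_⟩
  obtain ⟨v, m, hm, _, ht⟩ := ext_norm ht2
  have : t.n = m := ht.1
  omega
end

section
/- Let κ be an inaccessible cardinal, let ⟨μ_n : n < ω⟩ be a strictly increasing sequence of cardinals with μ_0 = κ, and for each n < ω let U_n be a κ-complete fine normal ultrafilter on 𝒫_κ(μ_n). Then the diagonal supercompact Prikry forcing ℚ built from ⟨U_n : n < ω⟩, equipped with the length function l(p) = (number of finite components of p), is κ-geometric. -/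
theorem dx_complete {κ μ : Cardinal.{0}} {W : Set (Set (Set Ordinal.{0}))}
    (hW : DComplete κ μ W) {ι : Type 1} (hι : Cardinal.mk ι < Cardinal.lift.{1} κ)
    (f : ι → Set (Set Ordinal.{0})) (hf : ∀ i, f i ∈ W) :
    (Pkm κ μ ∩ ⋂ i, f i) ∈ W := by
  classical
  obtain ⟨c, hcκ, hc⟩ := Cardinal.lt_lift_iff.1 hι
  have h1 : Cardinal.mk (Set.Iio c.ord) = Cardinal.mk ι := by
    rw [Cardinal.mk_Iio_ordinal, Cardinal.card_ord, hc]
  obtain ⟨e⟩ := Cardinal.eq.1 h1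
  have := hW c.ord (Cardinal.ord_lt_ord.2 hcκ)
    (fun o => if h : o < c.ord then f (e ⟨o, h⟩) else Set.univ) (by
      intro i hi
      simp only [hi, dif_pos]
      exact hf _)
  convert this using 2
  ext b
  simp only [Set.mem_iInter, Set.mem_Iio]
  constructor
  · intro h i hi
    simp only [hi, dif_pos]
    exact h _
  · intro h i
    have := h (e.symm i).1 (e.symm i).2
    rw [dif_pos (show (e.symm i).1 < c.ord from (e.symm i).2)] at this
    simpa using this

/-- truncation of a stem -/
def dxTr (n : ℕ) (s : ℕ → Set Ordinal.{0}) : ℕ → Set Ordinal.{0} :=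
  fun i => if i < n then s i else ∅

theorem dx_small {κ : Cardinal.{0}} (hκ : κ.IsInaccessible) (a : Set Ordinal.{0})
    (ha : Cardinal.mk a < Cardinal.lift.{1} κ) :
    Cardinal.mk (ULift.{1} ℕ × Set (ULift.{1} ℕ × a)) < Cardinal.lift.{1} κ := by
  obtain ⟨c, hcκ, hc⟩ := Cardinal.lt_lift_iff.1 ha
  have h0 := hκ.aleph0_lt
  have : Cardinal.mk (ULift.{1} ℕ × Set (ULift.{1} ℕ × a)) =
      Cardinal.lift.{1} (Cardinal.aleph0 * 2 ^ (Cardinal.aleph0 * c)) := by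
    simp [← hc]
  rw [this, Cardinal.lift_lt]
  refine Cardinal.mul_lt_of_lt h0.le h0 ?_
  exact hκ.isStrongLimit.two_power_lt (Cardinal.mul_lt_of_lt h0.le h0 hcκ)

theorem dx_Pkm_mono {κ μ ν : Cardinal.{0}} (h : μ ≤ ν) : Pkm κ μ ⊆ Pkm κ ν := by
  intro a ha
  exact ⟨fun x hx => lt_of_lt_of_le (ha.1 hx) (Cardinal.ord_le_ord.2 h), ha.2⟩

theorem dx_diag {κ : Cardinal.{0}} (hκ : κ.IsInaccessible)
    {μ : Cardinal.{0}} {W : Set (Set (Set Ordinal.{0}))}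
    (hU : DIsUltra κ μ W) (hC : DComplete κ μ W) (hN : DNormal κ μ W)
    (Z : ℕ → (ℕ → Set Ordinal.{0}) → Set (Set Ordinal.{0}))
    (hZ : ∀ n s, Z n s ∈ W) :
    ∃ Y ∈ W, ∀ b ∈ Y, ∀ n s, (∀ i < n, s i ∈ Pkm κ μ) →
      (∀ i < n, SubTilde κ (s i) b) → (∀ i j, i < j → j < n → SubTilde κ (s i) (s j)) →
      b ∈ Z n (dxTr n s) := by
  let A : Set Ordinal.{0} → Set (Set Ordinal.{0}) := fun a =>
    Pkm κ μ ∩ ⋂ i : ULift.{1} ℕ × Set (ULift.{1} ℕ × a),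
      Z i.1.down (fun k => {x | ∃ h : x ∈ a, (⟨k⟩, ⟨x, h⟩) ∈ i.2})
  have hA := hN A (fun a ha => dx_complete hC (dx_small hκ a ha.2) _ (fun i => hZ _ _))
  refine ⟨_, hU.2.2.2.2.1 _ _ hA (hZ 0 (fun _ => ∅)), ?_⟩
  rintro b ⟨⟨hb, -, hb2⟩, hb0⟩ n s hs hsb hss
  rcases n with _ | n
  · have : dxTr 0 s = fun _ => ∅ := by funext i; simp [dxTr]
    rw [this]; exact hb0
  · have h1 := hb2 (s n) (hs n (by omega)) (hsb n (by omega))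
    have h2 := Set.mem_iInter.1 h1.2 (⟨n+1⟩, {y | y.2.1 ∈ dxTr (n+1) s y.1.down})
    have hsub : ∀ i x, x ∈ dxTr (n+1) s i → x ∈ s n := by
      intro i x hx
      unfold dxTr at hx
      split_ifs at hx with h
      · rcases Nat.lt_succ_iff_lt_or_eq.1 h with h | h
        · exact (hss i n h (by omega)).1 hx
        · exact h ▸ hx
      · exact hx.elim
    convert h2 using 1
    congr 1
    funext i
    ext x
    simp only [Set.mem_ofPred_eq]
    exact ⟨fun h => ⟨hsub i x h, h⟩, fun ⟨_, h⟩ => h⟩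

/-- k-goodness of a stem -/
def dxGood (κ : Cardinal.{0}) (μ : ℕ → Cardinal.{0}) (U : ℕ → Set (Set (Set Ordinal.{0})))
    (D : Set QCond) : ℕ → ℕ → (ℕ → Set Ordinal.{0}) → Prop
  | 0, n, s => ∃ X, (⟨n, s, X⟩ : QCond) ∈ D
  | k+1, n, s => {b ∈ Pkm κ (μ n) | dxGood κ μ U D k (n+1) (Function.update s n b)} ∈ U n

theorem dx_ext {κ : Cardinal.{0}} {r p : QCond} (h : QExt κ r p) :
    p.n ≤ r.n ∧ (∀ i < p.n, r.a i = p.a i) ∧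
    (∀ j, p.n ≤ j → j < r.n → r.a j ∈ p.X j) ∧ (∀ m, r.n ≤ m → r.X m ⊆ p.X m) := by
  rcases h with ⟨h1, h2, h3⟩ | ⟨v, m, hm, hv, h1, h2, h3⟩
  · exact ⟨h1.ge, h2, fun j h h' => by omega, fun m hm => h3 m (by omega)⟩
  · simp only [QOplus] at h1 h2 h3
    subst h1
    refine ⟨hm, fun i hi => ?_, fun j hj hj' => ?_, fun m hm' x hx => (h3 m hm' hx).1⟩
    · rw [h2 i (by omega), if_pos hi]
    · rw [h2 j hj', if_neg (by omega)]; exact hv.1 j hj hj'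

theorem dx_tr_succ (n : ℕ) (s : ℕ → Set Ordinal.{0}) :
    dxTr (n+1) s = Function.update (dxTr n s) n (s n) := by
  funext i
  by_cases h : i = n
  · subst h; simp [dxTr]
  · have : i < n + 1 ↔ i < n := by omega
    simp [dxTr, Function.update_of_ne h, this]

theorem dx_tr_congr {n : ℕ} {s t : ℕ → Set Ordinal.{0}} (h : ∀ i < n, s i = t i) :
    dxTr n s = dxTr n t := by
  funext i
  unfold dxTr
  split_ifs with h'
  · exact h i h'
  · rfl

theorem dx_main (κ : Cardinal.{0}) (hκ : κ.IsInaccessible)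
    (μ : ℕ → Cardinal.{0}) (hμ : StrictMono μ)
    (U : ℕ → Set (Set (Set Ordinal.{0})))
    (hU : ∀ n : ℕ, DIsUltra κ (μ n) (U n) ∧ DComplete κ (μ n) (U n) ∧
      DFine κ (μ n) (U n) ∧ DNormal κ (μ n) (U n))
    (D : Set QCond) (hD : QDenseOpen κ μ U D) :
    ∃ Y : ℕ → Set (Set Ordinal.{0}), (∀ m, Y m ∈ U m) ∧
      ∀ p, QIsCond κ μ U p → (∀ m, p.n ≤ m → p.X m ⊆ Y m) →
        ∃ N, ∀ r, QIsCond κ μ U r → QExt κ r p → N ≤ r.n → r ∈ D := by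
  classical
  have hX : ∀ n s, ∃ X : ℕ → Set (Set Ordinal.{0}), (∀ m, X m ∈ U m) ∧
      ((∃ X, (⟨n, s, X⟩ : QCond) ∈ D) →
        ∃ X', (⟨n, s, X'⟩ : QCond) ∈ D ∧ ∀ m, n ≤ m → X m ⊆ X' m) := by
    intro n s
    by_cases h : ∃ X, (⟨n, s, X⟩ : QCond) ∈ D
    · obtain ⟨X, hX⟩ := h
      refine ⟨fun m => if n ≤ m then X m else Pkm κ (μ m), ?_, fun _ => ⟨X, hX, ?_⟩⟩
      · intro m
        dsimp only
        split_ifs with hm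
        · exact (hD.1 _ hX).2.1 m hm
        · exact (hU m).1.2.1
      · intro m hm
        simp [hm]
    · exact ⟨fun m => Pkm κ (μ m), fun m => (hU m).1.2.1, fun h' => (h h').elim⟩
  choose X hXU hXD using hX
  have hG : ∀ n s, ∃ G ∈ U n, ∀ b ∈ G, ∀ k,
      (dxGood κ μ U D k (n+1) (Function.update s n b) ↔ dxGood κ μ U D (k+1) n s) := by
    intro n s
    let B : ℕ → Set (Set Ordinal.{0}) := fun k =>
      {b ∈ Pkm κ (μ n) | dxGood κ μ U D k (n+1) (Function.update s n b)}
    let f : ULift.{1} ℕ → Set (Set Ordinal.{0}) := fun k =>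
      if B k.down ∈ U n then B k.down else Pkm κ (μ n) \ B k.down
    have hf : ∀ i, f i ∈ U n := by
      intro i
      dsimp only [f]
      split_ifs with h
      · exact h
      · exact ((hU n).1.2.2.2.2.2 (B i.down) (fun b hb => hb.1)).resolve_left h
    refine ⟨_, dx_complete (hU n).2.1 ?_ f hf, ?_⟩
    · simpa using hκ.aleph0_lt
    · rintro b ⟨hb, hb'⟩ k
      have h1 := Set.mem_iInter.1 hb' ⟨k⟩
      have h2 : dxGood κ μ U D (k+1) n s ↔ B k ∈ U n := Iff.rfl
      rw [h2]
      dsimp only [f] at h1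
      split_ifs at h1 with h
      · exact ⟨fun _ => h, fun _ => h1.2⟩
      · exact ⟨fun h' => (h1.2 ⟨hb, h'⟩).elim, fun h' => (h h').elim⟩
  choose G hGU hGg using hG
  have hY : ∀ m, ∃ Y ∈ U m, ∀ b ∈ Y, ∀ n s, (∀ i < n, s i ∈ Pkm κ (μ m)) →
      (∀ i < n, SubTilde κ (s i) b) → (∀ i j, i < j → j < n → SubTilde κ (s i) (s j)) →
      b ∈ X n (dxTr n s) m ∧ (n = m → b ∈ G n (dxTr n s)) := by
    intro m
    obtain ⟨Y, hYU, hY⟩ := dx_diag hκ (hU m).1 (hU m).2.1 (hU m).2.2.2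
      (fun n s => X n s m ∩ (if n = m then G m s else Pkm κ (μ m))) (by
        intro n s
        refine (hU m).1.2.2.2.2.1 _ _ (hXU n s m) ?_
        split_ifs
        · exact hGU m s
        · exact (hU m).1.2.1)
    refine ⟨Y, hYU, fun b hb n s h1 h2 h3 => ?_⟩
    have := hY b hb n s h1 h2 h3
    refine ⟨this.1, ?_⟩
    rintro rfl
    simpa using this.2
  choose Y hYU hYb using hY
  refine ⟨Y, hYU, fun p hp hpY => ?_⟩
  -- key step
  have key : ∀ r, QIsCond κ μ U r → QExt κ r p → ∀ j k, p.n + j ≤ r.n →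
      (dxGood κ μ U D k (p.n + j) (dxTr (p.n + j) r.a) ↔
        dxGood κ μ U D (k + j) p.n (dxTr p.n p.a)) := by
    intro r hr hrp j
    obtain ⟨e1, e2, e3, e4⟩ := dx_ext hrp
    induction j with
    | zero =>
      intro k _
      rw [Nat.add_zero, Nat.add_zero, dx_tr_congr e2]
    | succ j ih =>
      intro k hj
      have hmem := hpY _ (by omega) (e3 (p.n + j) (by omega) (by omega))
      have h1 := (hYb _ _ hmem (p.n + j) r.a
        (fun i hi => dx_Pkm_mono (hμ.monotone hi.le) (hr.1 i (by omega)).1)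
        (fun i hi => hr.2.2.2 i _ hi (by omega))
        (fun i i' h h' => hr.2.2.2 i i' h (by omega))).2 rfl
      have h2 := hGg _ _ _ h1 k
      rw [← dx_tr_succ] at h2
      have h3 := ih (k+1) (by omega)
      rw [show k + 1 + j = k + (j + 1) by omega] at h3
      exact h2.trans h3
  obtain ⟨r₀, hr₀, hr₀p⟩ := hD.2.1 p hp
  have hr₀c := hD.1 _ hr₀
  have hle := (dx_ext hr₀p).1
  obtain ⟨j, hj⟩ := Nat.exists_eq_add_of_le hle
  have g0 : dxGood κ μ U D 0 (p.n + j) (dxTr (p.n + j) r₀.a) := by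
    refine ⟨r₀.X, hD.2.2 r₀ hr₀ _ ?_ ?_⟩
    · obtain ⟨c1, c2, c3, c4⟩ := hr₀c
      refine ⟨?_, ?_, ?_, ?_⟩
      · intro l hl
        have hl' : l < p.n + j := hl
        simp only [dxTr, if_pos hl']
        exact c1 l (by omega)
      · intro m hm
        exact c2 m (by rw [hj]; exact hm)
      · intro m hm b hb l hl
        have hl' : l < p.n + j := hl
        simp only [dxTr, if_pos hl']
        exact c3 m (by rw [hj]; exact hm) b hb l (by omega)
      · intro i i' h h'
        have hl' : i' < p.n + j := h'
        simp only [dxTr, if_pos hl', if_pos (h.trans hl')]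
        exact c4 i i' h (by omega)
    · refine Or.inl ⟨hj.symm, ?_, fun m _ => subset_rfl⟩
      intro l hl
      simp only [dxTr]
      rw [if_pos (by omega)]
  have g1 := (key r₀ hr₀c hr₀p j 0 (by omega)).1 g0
  refine ⟨p.n + j, fun r hr hrp hrn => ?_⟩
  have g2 := (key r hr hrp j 0 hrn).2 g1
  obtain ⟨X', hX', hXX⟩ := hXD _ _ g2
  obtain ⟨e1, e2, e3, e4⟩ := dx_ext hrp
  refine hD.2.2 _ hX' r hr (Or.inr ⟨r.a, r.n, hrn, ⟨?_, ?_⟩, rfl, ?_, ?_⟩)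
  · intro i hi hi'
    have hi : p.n + j ≤ i := hi
    refine hXX i hi (hYb _ _ (hpY _ (by omega) (e3 i (by omega) hi')) (p.n + j) r.a
        (fun l hl => dx_Pkm_mono (hμ.monotone (by omega)) (hr.1 l (by omega)).1)
        (fun l hl => hr.2.2.2 l _ (by omega) (by omega))
        (fun l i' h h' => hr.2.2.2 l i' h (by omega))).1
  · intro i i' _ h h'
    exact hr.2.2.2 i i' h h'
  · intro l hl
    simp only [QOplus, dxTr]
    split_ifs <;> rfl
  · intro m hm b hb
    have hm : r.n ≤ m := hm
    refine ⟨hXX m (by omega) (hYb _ _ (hpY _ (by omega) (e4 m hm hb)) (p.n + j) r.a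
        (fun l hl => dx_Pkm_mono (hμ.monotone (by omega)) (hr.1 l (by omega)).1)
        (fun l hl => hr.2.2.1 m hm b hb l (by omega))
        (fun l i' h h' => hr.2.2.2 l i' h (by omega))).1, ?_⟩
    intro i _ hi
    exact hr.2.2.1 m hm b hb i hi

/-- for any strictly increasing sequence of cardinals
`⟨μ n : n < ω⟩` with `μ 0 = κ` and κ-complete fine normal ultrafilters `U n` on
`𝒫_κ(μ n)`, the diagonal supercompact Prikry forcing built from `⟨U n : n < ω⟩`,
with length function `l p = p.n`, is κ-geometric. -/
theorem diagPrikry_kappa_geometric_general (κ : Cardinal.{0}) (hκ : κ.IsInaccessible)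
    (μ : ℕ → Cardinal.{0}) (hμ0 : μ 0 = κ) (hμ : StrictMono μ)
    (U : ℕ → Set (Set (Set Ordinal.{0})))
    (hU : ∀ n : ℕ, DIsUltra κ (μ n) (U n) ∧ DComplete κ (μ n) (U n) ∧
      DFine κ (μ n) (U n) ∧ DNormal κ (μ n) (U n)) :
    ∀ γ < κ.ord, ∀ D : Ordinal.{0} → Set QCond,
      (∀ β < γ, QDenseOpen κ μ U (D β)) →
      ∀ p, QIsCond κ μ U p →
        ∃ q, QIsCond κ μ U q ∧ QExt κ q p ∧
          ∀ F : Set QCond, QIsFilter κ μ U F → q ∈ F →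
            (∀ n : ℕ, ∃ r ∈ F, n < r.n) →
            ∀ β < γ, ∃ r ∈ F, r ∈ D β := by
  classical
  intro γ hγ D hD p hp
  have hY : ∀ β, ∃ Y : ℕ → Set (Set Ordinal.{0}), β < γ → (∀ m, Y m ∈ U m) ∧
      ∀ p, QIsCond κ μ U p → (∀ m, p.n ≤ m → p.X m ⊆ Y m) →
        ∃ N, ∀ r, QIsCond κ μ U r → QExt κ r p → N ≤ r.n → r ∈ D β := by
    intro β
    by_cases h : β < γ
    · obtain ⟨Y, hY⟩ := dx_main κ hκ μ hμ U hU (D β) (hD β h)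
      exact ⟨Y, fun _ => hY⟩
    · exact ⟨fun _ => ∅, fun h' => (h h').elim⟩
  choose Y hY using hY
  let q : QCond := ⟨p.n, p.a, fun m => p.X m ∩ (Pkm κ (μ m) ∩ ⋂ i ∈ Set.Iio γ, Y i m)⟩
  have hq : QIsCond κ μ U q := by
    refine ⟨hp.1, fun m hm => ?_, fun m hm b hb => hp.2.2.1 m hm b hb.1, hp.2.2.2⟩
    exact (hU m).1.2.2.2.2.1 _ _ (hp.2.1 m hm)
      ((hU m).2.1 γ hγ (fun i => Y i m) (fun i hi => (hY i hi).1 m))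
  refine ⟨q, hq, Or.inl ⟨rfl, fun _ _ => rfl, fun m _ => Set.inter_subset_left⟩, ?_⟩
  intro F hF hqF hlen β hβ
  obtain ⟨N, hN⟩ := (hY β hβ).2 q hq (fun m _ b hb => Set.mem_iInter₂.1 hb.2.2 β hβ)
  obtain ⟨t, ht, htN⟩ := hlen N
  obtain ⟨r, hr, hrq, hrt⟩ := hF.2.2.2 q hqF t ht
  have := (dx_ext hrt).1
  exact ⟨r, hr, hN r (hF.2.1 r hr) hrq (by omega)⟩
end
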